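/- arXiv:1507.00049 — 7 statements merged into one kernel-verified Lean document; each statement's English description precedes it below -/
import Mathlib

section
/- Let X be a complex Banach space and T a bounded linear operator on X whose spectrum is contained in the closed unit disc and which satisfies ‖(z−1)(zI−T)⁻¹‖ ≤ C for every z ∈ ℂ with |z| > 1, where C ≥ 1. Set θ = arccos(1/C). Then for every η ∈ (θ, π/2], every z ∈ ℂ lying outside the closure of the Stolz-type domain B_η belongs to the resolvent set of T and satisfies ‖(z−1)(zI−T)⁻¹‖ ≤ C/(1 − cos η / cos θ). -/
open Metric Real

/-- The Stolz-type domain `B_η`: the interior of the convex hull of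
`{1} ∪ {z : |z| ≤ sin η}`. -/
noncomputable def stolzDomain (η : ℝ) : Set ℂ :=
  interior (convexHull ℝ ({1} ∪ Metric.closedBall (0 : ℂ) (Real.sin η)))

/-- If `(c, b)` and `(k, t)` are points of the unit circle on different sides of the vertical line
through `m ≥ 0`, then the distance of `(c, b)` to that line is at most `√(1 - m²)` times the
distance between the two points. -/
lemma sq_sub_le_mul_dist_sq_of_unit_circle {c b k t m : ℝ} (hcb : c ^ 2 + b ^ 2 = 1)
    (hkt : k ^ 2 + t ^ 2 = 1) (hm : 0 ≤ m) (hkm : k ≤ m) (hmc : m ≤ c) :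
    (c - m) ^ 2 ≤ (1 - m ^ 2) * ((c - k) ^ 2 + (b - t) ^ 2) := by
  have hc1 : c ≤ 1 := by nlinarith [sq_nonneg b]
  have hc0 : 0 ≤ c := hm.trans hmc
  obtain ⟨n, hn0, hn⟩ : ∃ n : ℝ, 0 ≤ n ∧ n ^ 2 = 1 - m ^ 2 :=
    ⟨√(1 - m ^ 2), Real.sqrt_nonneg _, Real.sq_sqrt (by nlinarith)⟩
  have hb2 : |b| ^ 2 = b ^ 2 := sq_abs b
  have ht2 : |t| ^ 2 = t ^ 2 := sq_abs t
  have hb0 := abs_nonneg b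
  have ht0 := abs_nonneg t
  have hbt : b * t ≤ |b| * |t| := (le_abs_self _).trans (abs_mul b t).le
  have hbn : |b| ≤ n := by
    apply abs_le_of_sq_le_sq' _ hn0 |>.2
    nlinarith
  have hinner : c * k + |b| * |t| ≤ c * m + |b| * n := by
    rcases le_or_gt |t| n with h | h
    · nlinarith [mul_le_mul_of_nonneg_left h hb0, mul_le_mul_of_nonneg_left hkm hc0]
    · have hsum : 0 < m + k := by
        have : n ^ 2 < |t| ^ 2 := by nlinarith
        nlinarith
      have hle : |b| * (m + k) ≤ c * (|t| + n) := by
        have h1 : |b| * (m + k) ≤ |b| * (2 * c) :=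
          mul_le_mul_of_nonneg_left (by linarith) hb0
        have h2 : c * (2 * |b|) ≤ c * (|t| + n) :=
          mul_le_mul_of_nonneg_left (by linarith) hc0
        linarith
      have h3 : (|t| - n) * (|b| * (m + k)) ≤ (|t| - n) * (c * (|t| + n)) :=
        mul_le_mul_of_nonneg_left hle (by linarith)
      have h4 : (m - k) * (m + k) = (|t| - n) * (|t| + n) := by nlinarith
      have h5 : (m + k) * (|b| * (|t| - n)) ≤ (m + k) * (c * (m - k)) := by
        calc (m + k) * (|b| * (|t| - n)) = (|t| - n) * (|b| * (m + k)) := by ring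
          _ ≤ (|t| - n) * (c * (|t| + n)) := h3
          _ = c * ((m - k) * (m + k)) := by rw [h4]; ring
          _ = (m + k) * (c * (m - k)) := by ring
      have h6 := le_of_mul_le_mul_left h5 hsum
      linarith
  have hdist : (c - m) ^ 2 + (n - |b|) ^ 2 ≤ (c - k) ^ 2 + (b - t) ^ 2 := by nlinarith
  have hcs : (c - m) * m ≤ n * (n - |b|) := by nlinarith [sq_nonneg (c - m), sq_nonneg (n - |b|)]
  have hcs2 : ((c - m) * m) ^ 2 ≤ (n * (n - |b|)) ^ 2 :=
    pow_le_pow_left₀ (mul_nonneg (by linarith) hm) hcs 2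
  rw [← hn]
  calc (c - m) ^ 2 = (c - m) ^ 2 * n ^ 2 + ((c - m) * m) ^ 2 := by rw [hn]; ring
    _ ≤ (c - m) ^ 2 * n ^ 2 + (n * (n - |b|)) ^ 2 := by linarith
    _ = n ^ 2 * ((c - m) ^ 2 + (n - |b|) ^ 2) := by ring
    _ ≤ n ^ 2 * ((c - k) ^ 2 + (b - t) ^ 2) := mul_le_mul_of_nonneg_left hdist (sq_nonneg n)

/-- A point outside the closure of the Stolz-type domain is strictly separated from it by a line
with unit normal vector `p + q i`. -/
lemma exists_unit_normal_of_notMem_closure_stolzDomain {η : ℝ} (hη : 0 < Real.sin η) {z : ℂ}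
    (hz : z ∉ closure (stolzDomain η)) :
    ∃ p q : ℝ, p ^ 2 + q ^ 2 = 1 ∧ p < p * z.re + q * z.im ∧
      Real.sin η < p * z.re + q * z.im := by
  set K : Set ℂ := convexHull ℝ ({1} ∪ Metric.closedBall (0 : ℂ) (Real.sin η)) with hK
  have hsub : {1} ∪ Metric.closedBall (0 : ℂ) (Real.sin η) ⊆ K := subset_convexHull ℝ _
  have hconv : Convex ℝ K := convex_convexHull ℝ _
  have hint : (interior K).Nonempty :=
    ⟨0, interior_mono (Metric.ball_subset_closedBall.trans (Set.subset_union_right.trans hsub))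
      (by rw [Metric.isOpen_ball.interior_eq]; exact Metric.mem_ball_self hη)⟩
  rw [stolzDomain, hconv.closure_interior_eq_closure_of_nonempty_interior hint] at hz
  obtain ⟨f, u, hfu, huz⟩ := geometric_hahn_banach_closed_point hconv.closure isClosed_closure hz
  have hfK : ∀ a ∈ {1} ∪ Metric.closedBall (0 : ℂ) (Real.sin η), f a < f z := fun a ha =>
    (hfu a (subset_closure (hsub ha))).trans huz
  have hf : ∀ a : ℂ, f a = f 1 * a.re + f Complex.I * a.im := fun a => by
    have ha : a = a.re • (1 : ℂ) + a.im • Complex.I := by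
      simp [Complex.re_add_im]
    conv_lhs => rw [ha]
    rw [map_add, map_smul, map_smul, smul_eq_mul, smul_eq_mul]
    ring
  set P := f 1
  set Q := f Complex.I
  have h0 : 0 < f z := by
    simpa using hfK 0 (Or.inr (Metric.mem_closedBall_self hη.le))
  obtain ⟨N, hN0, hN⟩ : ∃ N : ℝ, 0 ≤ N ∧ N ^ 2 = P ^ 2 + Q ^ 2 :=
    ⟨√(P ^ 2 + Q ^ 2), Real.sqrt_nonneg _, Real.sq_sqrt (by positivity)⟩
  have hNpos : 0 < N := by
    refine lt_of_le_of_ne hN0 fun h => ?_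
    have hP : P = 0 := by nlinarith [sq_nonneg P, sq_nonneg Q]
    have hQ : Q = 0 := by nlinarith [sq_nonneg P, sq_nonneg Q]
    rw [hf, hP, hQ] at h0
    simp at h0
  have hdiv : P / N * z.re + Q / N * z.im = f z / N := by rw [hf z]; ring
  have hunit : (P / N) ^ 2 + (Q / N) ^ 2 = 1 := by
    rw [div_pow, div_pow, ← add_div, ← hN, div_self (by positivity)]
  refine ⟨P / N, Q / N, hunit, ?_, ?_⟩
  · rw [hdiv]
    exact div_lt_div_of_pos_right (hfK 1 (Or.inl rfl)) hNpos
  · rw [hdiv, lt_div_iff₀ hNpos]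
    have hmem : (⟨Real.sin η * (P / N), Real.sin η * (Q / N)⟩ : ℂ) ∈
        {1} ∪ Metric.closedBall (0 : ℂ) (Real.sin η) := by
      refine Or.inr ?_
      rw [mem_closedBall_zero_iff]
      refine abs_le_of_sq_le_sq' ?_ hη.le |>.2
      rw [Complex.sq_norm, Complex.normSq_mk]
      apply le_of_eq
      linear_combination Real.sin η ^ 2 * hunit
    have h := hfK _ hmem
    rw [hf] at h
    have hs : P * (Real.sin η * (P / N)) + Q * (Real.sin η * (Q / N)) = Real.sin η * N := by
      field_simp
      rw [hN]
    linarith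

/-- A point of the closed unit disc outside the closure of the Stolz-type domain is close to a
point `w` of the unit circle, relative to the distance from `w` to `1`. -/
lemma exists_norm_eq_one_of_notMem_closure_stolzDomain {η : ℝ} (hη : 0 < Real.sin η)
    (hcos : 0 ≤ Real.cos η) {z : ℂ} (hz1 : ‖z‖ ≤ 1) (hz : z ∉ closure (stolzDomain η)) :
    ∃ w : ℂ, ‖w‖ = 1 ∧ w ≠ 1 ∧ ‖z - 1‖ ≤ ‖w - 1‖ ∧ ‖w - z‖ ≤ Real.cos η * ‖w - 1‖ := by
  obtain ⟨p, q, hpq, hp, hσ⟩ := exists_unit_normal_of_notMem_closure_stolzDomain hη hz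
  obtain ⟨x, y⟩ := z
  simp only at hp hσ
  have hxy : x ^ 2 + y ^ 2 ≤ 1 := by
    have h : ‖(⟨x, y⟩ : ℂ)‖ ^ 2 ≤ 1 := pow_le_one₀ (norm_nonneg _) hz1
    rw [Complex.sq_norm, Complex.normSq_mk] at h
    linarith
  obtain ⟨m, b, hx, hy, hm⟩ : ∃ m b : ℝ, x = p * m - q * b ∧ y = q * m + p * b ∧
      p * x + q * y = m :=
    ⟨p * x + q * y, p * y - q * x, by linear_combination -x * hpq,
      by linear_combination -y * hpq, rfl⟩
  rw [hm] at hp hσ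
  have hmb : m ^ 2 + b ^ 2 ≤ 1 := by
    have h : x ^ 2 + y ^ 2 = m ^ 2 + b ^ 2 := by
      rw [hx, hy]; linear_combination (m ^ 2 + b ^ 2) * hpq
    linarith
  have hm0 : 0 < m := hη.trans hσ
  obtain ⟨c, hc0, hc⟩ : ∃ c : ℝ, 0 ≤ c ∧ c ^ 2 = 1 - b ^ 2 :=
    ⟨√(1 - b ^ 2), Real.sqrt_nonneg _, Real.sq_sqrt (by linarith [sq_nonneg m])⟩
  have hmc : m ≤ c := abs_le_of_sq_le_sq' (by linarith) hc0 |>.2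
  have hcore := sq_sub_le_mul_dist_sq_of_unit_circle (c := c) (b := b) (k := p) (t := -q) (m := m)
    (by linarith) (by linarith) hm0.le hp.le hmc
  have hdist (r : ℝ) : ‖(⟨p * r - q * b, q * r + p * b⟩ : ℂ) - 1‖ ^ 2
      = (r - p) ^ 2 + (b - -q) ^ 2 := by
    rw [Complex.sq_norm, Complex.normSq_apply]
    simp only [Complex.sub_re, Complex.sub_im, Complex.one_re, Complex.one_im]
    linear_combination (r ^ 2 + b ^ 2 - 1) * hpq
  rw [hx, hy]
  refine ⟨⟨p * c - q * b, q * c + p * b⟩, ?_, fun h => ?_, ?_, ?_⟩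
  · rw [← sq_eq_sq₀ (norm_nonneg _) zero_le_one, Complex.sq_norm, Complex.normSq_mk]
    linear_combination (c ^ 2 + b ^ 2) * hpq + hc
  · have h0 := hdist c
    rw [h, sub_self, norm_zero] at h0
    nlinarith [sq_nonneg (b - -q)]
  · refine abs_le_of_sq_le_sq' ?_ (norm_nonneg _) |>.2
    rw [hdist, hdist]
    gcongr
  · refine abs_le_of_sq_le_sq' ?_ (by positivity) |>.2
    have hws : ‖(⟨p * c - q * b, q * c + p * b⟩ : ℂ) - ⟨p * m - q * b, q * m + p * b⟩‖ ^ 2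
        = (c - m) ^ 2 := by
      rw [Complex.sq_norm, Complex.normSq_apply]
      simp only [Complex.sub_re, Complex.sub_im]
      linear_combination (c - m) ^ 2 * hpq
    rw [hws, mul_pow, hdist]
    refine hcore.trans (mul_le_mul_of_nonneg_right ?_ (by positivity))
    nlinarith [Real.sin_sq_add_cos_sq η]

section Resolvent

variable {A : Type*} [NormedRing A] [NormedAlgebra ℂ A] [CompleteSpace A]

/-- Neumann series perturbation of the resolvent. -/
lemma mem_resolventSet_and_norm_resolvent_le {a : A} {w z : ℂ} {q : ℝ}
    (hw : w ∈ resolventSet ℂ a) (hq : q < 1) (hwz : ‖w - z‖ * ‖resolvent a w‖ ≤ q) :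
    z ∈ resolventSet ℂ a ∧ ‖resolvent a z‖ ≤ ‖resolvent a w‖ / (1 - q) := by
  have hmul : (algebraMap ℂ A w - a) * resolvent a w = 1 := Ring.mul_inverse_cancel _ hw
  have hsmall : ‖(w - z) • resolvent a w‖ < 1 := by
    rw [norm_smul]; exact hwz.trans_lt hq
  have hfac : algebraMap ℂ A z - a
      = (algebraMap ℂ A w - a) * (1 - (w - z) • resolvent a w) := by
    rw [mul_sub, mul_one, mul_smul_comm, hmul, sub_smul, ← Algebra.algebraMap_eq_smul_one,
      ← Algebra.algebraMap_eq_smul_one]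
    abel
  have hz : z ∈ resolventSet ℂ a := by
    rw [spectrum.mem_resolventSet_iff, hfac]
    exact IsUnit.mul hw (isUnit_one_sub_of_norm_lt_one hsmall)
  refine ⟨hz, ?_⟩
  have hinv : resolvent a z * (algebraMap ℂ A z - a) = 1 := Ring.inverse_mul_cancel _ hz
  have hid : resolvent a z = resolvent a w + (w - z) • (resolvent a z * resolvent a w) := by
    have h : (1 : A) - (w - z) • resolvent a w = (algebraMap ℂ A z - a) * resolvent a w := by
      have hzw : algebraMap ℂ A z - a
          = (algebraMap ℂ A w - a) - (w - z) • (1 : A) := by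
        rw [sub_smul, ← Algebra.algebraMap_eq_smul_one, ← Algebra.algebraMap_eq_smul_one]
        abel
      rw [hzw, sub_mul, hmul, smul_mul_assoc, one_mul]
    have h' : resolvent a z * (1 - (w - z) • resolvent a w) = resolvent a w := by
      rw [h, ← mul_assoc, hinv, one_mul]
    rw [mul_sub, mul_one, mul_smul_comm] at h'
    exact sub_eq_iff_eq_add.1 h'
  have hnorm : ‖resolvent a z‖ ≤ ‖resolvent a w‖ + q * ‖resolvent a z‖ := by
    calc ‖resolvent a z‖ ≤ ‖resolvent a w‖ + ‖(w - z) • (resolvent a z * resolvent a w)‖ := by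
          conv_lhs => rw [hid]
          exact norm_add_le _ _
      _ ≤ ‖resolvent a w‖ + ‖w - z‖ * (‖resolvent a z‖ * ‖resolvent a w‖) := by
          rw [norm_smul]; gcongr; exact norm_mul_le _ _
      _ = ‖resolvent a w‖ + (‖w - z‖ * ‖resolvent a w‖) * ‖resolvent a z‖ := by ring
      _ ≤ ‖resolvent a w‖ + q * ‖resolvent a z‖ := by gcongr
  rw [le_div_iff₀ (by linarith)]
  linarith

/-- The Tadmor–Ritt resolvent bound extends to the unit circle without the point `1`. -/
lemma mem_resolventSet_and_norm_smul_resolvent_le_of_norm_eq_one {a : A} {C : ℝ} (hC : 1 ≤ C)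
    (hspec : spectrum ℂ a ⊆ Metric.closedBall (0 : ℂ) 1)
    (hres : ∀ z : ℂ, 1 < ‖z‖ → ‖(z - 1) • resolvent a z‖ ≤ C) {w : ℂ} (hw : ‖w‖ = 1)
    (hw1 : w ≠ 1) :
    w ∈ resolventSet ℂ a ∧ ‖(w - 1) • resolvent a w‖ ≤ C := by
  have hd : 0 < ‖w - 1‖ := norm_pos_iff.2 (sub_ne_zero.2 hw1)
  have hlim : Filter.Tendsto (fun ε : ℝ => (1 + ε : ℂ) * w) (nhdsWithin 0 (Set.Ioi 0))
      (nhds w) := by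
    refine Filter.Tendsto.mono_left ?_ nhdsWithin_le_nhds
    have hcont : Continuous fun ε : ℝ => (1 + ε : ℂ) * w := by fun_prop
    simpa using hcont.tendsto 0
  have hout : ∀ ε : ℝ, 0 < ε → 1 < ‖(1 + ε : ℂ) * w‖ := fun ε hε => by
    rw [norm_mul, hw, mul_one, ← Complex.ofReal_one, ← Complex.ofReal_add, Complex.norm_real,
      Real.norm_of_nonneg (by linarith)]
    linarith
  have hmem : w ∈ resolventSet ℂ a := by
    obtain ⟨ε, ⟨hεw, hεC⟩, hε⟩ : ∃ ε : ℝ, (‖w - 1‖ / 2 < ‖(1 + ε : ℂ) * w - 1‖ ∧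
        ‖(1 + ε : ℂ) * w - w‖ < ‖w - 1‖ / (4 * C)) ∧ 0 < ε := by
      have h1 := (hlim.sub_const 1).norm.eventually_const_lt (half_lt_self hd)
      have h2 := (hlim.sub_const w).norm.eventually_lt_const (u := ‖w - 1‖ / (4 * C))
        (by rw [sub_self, norm_zero]; positivity)
      exact ((h1.and h2).and self_mem_nhdsWithin).exists
    set v := (1 + ε : ℂ) * w
    have hv : v ∈ resolventSet ℂ a := by
      by_contra h
      have := mem_closedBall_zero_iff.1 (hspec h)
      linarith [hout ε hε]
    have hbound := hres v (hout ε hε)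
    rw [norm_smul] at hbound
    have hR : ‖resolvent a v‖ ≤ 2 * C / ‖w - 1‖ := by
      rw [le_div_iff₀ hd]
      nlinarith [norm_nonneg (resolvent a v)]
    refine (mem_resolventSet_and_norm_resolvent_le (z := w) hv (q := 1 / 2) (by norm_num) ?_).1
    calc ‖v - w‖ * ‖resolvent a v‖ ≤ ‖w - 1‖ / (4 * C) * (2 * C / ‖w - 1‖) := by gcongr
      _ = 1 / 2 := by field_simp; norm_num
  refine ⟨hmem, ?_⟩
  have hcont := (spectrum.hasDerivAt_resolvent_const_left hmem).continuousAt
  refine le_of_tendsto ((hlim.sub_const 1).smul (hcont.tendsto.comp hlim)).norm ?_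
  filter_upwards [self_mem_nhdsWithin] with ε hε using hres _ (hout ε hε)

end Resolvent

/-- If `T` is a Tadmor–Ritt operator with constant `C ≥ 1` and `θ = arccos (1/C)`, then
for every `η ∈ (θ, π/2]`, every `z` outside the closure of `B_η` lies in the resolvent set
of `T` and satisfies `‖(z-1)(zI-T)⁻¹‖ ≤ C / (1 - cos η / cos θ)`. -/
theorem resolvent_bound_outside_stolzDomain
    {X : Type*} [NormedAddCommGroup X] [NormedSpace ℂ X] [CompleteSpace X]
    (T : X →L[ℂ] X) (C : ℝ) (hC : 1 ≤ C)
    (hspec : spectrum ℂ T ⊆ Metric.closedBall (0 : ℂ) 1)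
    (hres : ∀ z : ℂ, 1 < ‖z‖ → ‖(z - 1) • resolvent T z‖ ≤ C) :
    ∀ η ∈ Set.Ioc (Real.arccos (1 / C)) (π / 2),
      ∀ z : ℂ, z ∉ closure (stolzDomain η) →
        z ∉ spectrum ℂ T ∧
        ‖(z - 1) • resolvent T z‖ ≤ C / (1 - Real.cos η / Real.cos (Real.arccos (1 / C))) := by
  intro η hη z hz
  have hC0 : 0 < C := by linarith
  have hinv : 1 / C ≤ 1 := (div_le_one hC0).2 hC
  have hcosθ : Real.cos (Real.arccos (1 / C)) = 1 / C :=
    Real.cos_arccos (by linarith [one_div_pos.2 hC0]) hinv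
  have hθ := Real.arccos_nonneg (1 / C)
  have hηpos : 0 < η := hθ.trans_lt hη.1
  have hsin : 0 < Real.sin η := Real.sin_pos_of_pos_of_lt_pi hηpos (by linarith [hη.2, Real.pi_pos])
  have hcos : 0 ≤ Real.cos η := Real.cos_nonneg_of_mem_Icc ⟨by linarith [Real.pi_pos], hη.2⟩
  have hcoslt : Real.cos η < 1 / C :=
    hcosθ ▸ Real.cos_lt_cos_of_nonneg_of_le_pi_div_two hθ hη.2 hη.1
  have hq : Real.cos η / (1 / C) < 1 := (div_lt_one (by positivity)).2 hcoslt
  have hq0 : 0 ≤ Real.cos η / (1 / C) := by positivity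
  rw [hcosθ]
  rcases lt_or_ge 1 ‖z‖ with h1 | h1
  · refine ⟨fun h => ?_, (hres z h1).trans ?_⟩
    · have := mem_closedBall_zero_iff.1 (hspec h)
      linarith
    · rw [le_div_iff₀ (by linarith)]
      nlinarith
  · obtain ⟨w, hw, hw1, hzw, hdist⟩ :=
      exists_norm_eq_one_of_notMem_closure_stolzDomain hsin hcos h1 hz
    obtain ⟨hmem, hbound⟩ :=
      mem_resolventSet_and_norm_smul_resolvent_le_of_norm_eq_one hC hspec hres hw hw1
    rw [norm_smul] at hbound
    obtain ⟨hzmem, hzR⟩ := mem_resolventSet_and_norm_resolvent_le (z := z) hmem hq (by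
      calc ‖w - z‖ * ‖resolvent T w‖ ≤ Real.cos η * ‖w - 1‖ * ‖resolvent T w‖ := by gcongr
        _ = Real.cos η * (‖w - 1‖ * ‖resolvent T w‖) := by ring
        _ ≤ Real.cos η * C := by gcongr
        _ = Real.cos η / (1 / C) := by field_simp)
    refine ⟨fun h => h hzmem, ?_⟩
    have hden : 0 ≤ 1 - Real.cos η / (1 / C) := by linarith
    calc ‖(z - 1) • resolvent T z‖ = ‖z - 1‖ * ‖resolvent T z‖ := norm_smul _ _
      _ ≤ ‖w - 1‖ * (‖resolvent T w‖ / (1 - Real.cos η / (1 / C))) := by gcongr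
      _ = ‖w - 1‖ * ‖resolvent T w‖ / (1 - Real.cos η / (1 / C)) := by ring
      _ ≤ C / (1 - Real.cos η / (1 / C)) := by gcongr
end

section
/- Let T be a bounded linear operator on a complex Banach space X. The following are equivalent: (i) the spectrum of T is contained in the closed unit disc and sup over z ∈ ℂ with |z| > 1 of ‖(z−1)(zI−T)⁻¹‖ is finite; (ii) both sup_{n ∈ ℕ} ‖Tⁿ‖ < ∞ and sup_{n ∈ ℕ, n ≥ 1} ‖n(Tⁿ − Tⁿ⁻¹)‖ < ∞. -/
open Metric

open Filter Topology

/-- The normalized integral of `‖1 - r e^{iθ}‖⁻²` over the circle is `(1 - r²)⁻¹`. -/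
lemma integral_inv_norm_one_sub_circleMap_sq {r : ℝ} (hr0 : 0 ≤ r) (hr1 : r < 1) :
    (2 * Real.pi)⁻¹ * ∫ θ in (0 : ℝ)..2 * Real.pi, (‖1 - circleMap 0 r θ‖ ^ 2)⁻¹ =
      (1 - r ^ 2)⁻¹ := by
  have hw : (r : ℂ) ∈ ball (0 : ℂ) 1 := by simpa [abs_of_nonneg hr0] using hr1
  have h := DiffContOnCl.circleAverage_poissonKernel_smul' (E := ℂ) (f := fun _ => 1)
    (c := 0) (R := 1) diffContOnCl_const hw
  have hsymm (θ : ℝ) : ‖circleMap 0 1 θ - r‖ = ‖1 - circleMap 0 r θ‖ := by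
    have hc : circleMap 0 1 θ * (starRingEnd ℂ) (1 - circleMap 0 r θ) = circleMap 0 1 θ - r := by
      simp only [circleMap, zero_add, map_sub, map_one, map_mul, Complex.conj_ofReal,
        ← Complex.exp_conj, Complex.conj_I, Complex.ofReal_one, one_mul, mul_sub, mul_one, mul_neg]
      rw [mul_left_comm, ← Complex.exp_add]
      simp
    rw [← hc, norm_mul, RCLike.norm_conj]
    simp
  have hpos : 0 < 1 - r ^ 2 := by nlinarith
  simp only [Real.circleAverage, sub_zero, hsymm, norm_circleMap_zero, Complex.norm_real,
    Real.norm_eq_abs, abs_one, sq_abs, one_pow, div_eq_mul_inv] at h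
  simp only [Complex.real_smul, mul_one] at h
  rw [intervalIntegral.integral_ofReal] at h
  norm_cast at h
  rw [intervalIntegral.integral_const_mul] at h
  exact eq_inv_of_mul_eq_one_right (by rw [mul_left_comm, h])

section Coefficients

variable {E : Type*} [NormedAddCommGroup E] [NormedSpace ℂ E] [CompleteSpace E]

/-- Cauchy estimate for a function dominated by `K / ‖1 - w‖²` on the circle of radius `r`. -/
lemma norm_coeff_mul_pow_le_of_norm_le_div_norm_one_sub_sq {a : ℕ → E} {F : ℂ → E} {K r : ℝ}
    (hr0 : 0 < r) (hr1 : r < 1) (hF : DifferentiableOn ℂ F (ball 0 1))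
    (hsum : ∀ᶠ w in 𝓝 (0 : ℂ), HasSum (fun n => w ^ n • a n) (F w))
    (hK : ∀ w : ℂ, ‖w‖ = r → ‖F w‖ ≤ K * (‖1 - w‖ ^ 2)⁻¹) (n : ℕ) :
    ‖a n‖ ≤ K * (1 - r ^ 2)⁻¹ * r⁻¹ ^ n := by
  have hsub : closedBall (0 : ℂ) r ⊆ ball 0 1 := closedBall_subset_ball hr1
  have hcauchy := (hF.mono hsub).hasFPowerSeriesOnBall (R := ⟨r, hr0.le⟩) hr0
  let p : FormalMultilinearSeries ℂ ℂ E :=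
    fun n => ContinuousMultilinearMap.mkPiRing ℂ (Fin n) (a n)
  have hp : HasFPowerSeriesAt F p 0 := by
    rw [hasFPowerSeriesAt_iff]
    filter_upwards [hsum] with w hw
    simpa [p, FormalMultilinearSeries.coeff] using hw
  have hpn : ‖a n‖ = ‖cauchyPowerSeries F 0 r n‖ := by
    have := hp.eq_formalMultilinearSeries hcauchy.hasFPowerSeriesAt
    have h2 := congrArg (fun q : FormalMultilinearSeries ℂ ℂ E => ‖q n‖) this
    exact (ContinuousMultilinearMap.norm_mkPiRing (a n)).symm.trans h2
  rw [hpn]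
  refine (norm_cauchyPowerSeries_le F 0 r n).trans ?_
  rw [abs_of_pos hr0, ← integral_inv_norm_one_sub_circleMap_sq hr0.le hr1]
  have hnorm (θ : ℝ) : ‖circleMap 0 r θ‖ = r := by simp [abs_of_pos hr0]
  have hne (θ : ℝ) : ‖1 - circleMap 0 r θ‖ ^ 2 ≠ 0 := by
    refine pow_ne_zero _ (norm_ne_zero_iff.2 (sub_ne_zero.2 fun h => ?_))
    have := hnorm θ
    rw [← h, norm_one] at this
    exact hr1.ne this.symm
  have hcont : Continuous fun θ => F (circleMap 0 r θ) :=
    hF.continuousOn.comp_continuous (continuous_circleMap 0 r) fun θ => by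
      simpa [abs_of_pos hr0] using hr1
  have hint : ∫ θ in (0 : ℝ)..2 * Real.pi, ‖F (circleMap 0 r θ)‖ ≤
      ∫ θ in (0 : ℝ)..2 * Real.pi, K * (‖1 - circleMap 0 r θ‖ ^ 2)⁻¹ := by
    refine intervalIntegral.integral_mono_on Real.two_pi_pos.le
      (hcont.norm.intervalIntegrable _ _) ?_ fun θ _ => hK _ (hnorm θ)
    refine Continuous.intervalIntegrable ?_ _ _
    exact continuous_const.mul
      (((continuous_const.sub (continuous_circleMap 0 r)).norm.pow 2).inv₀ hne)
  rw [intervalIntegral.integral_const_mul] at hint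
  rw [mul_left_comm K]
  gcongr

/-- Optimizing the radius in the Cauchy estimate: coefficients grow at most linearly. -/
lemma norm_coeff_le_of_norm_le_div_norm_one_sub_sq {a : ℕ → E} {F : ℂ → E} {K : ℝ}
    (hK0 : 0 ≤ K) (hF : DifferentiableOn ℂ F (ball 0 1))
    (hsum : ∀ᶠ w in 𝓝 (0 : ℂ), HasSum (fun n => w ^ n • a n) (F w))
    (hK : ∀ w : ℂ, 2⁻¹ ≤ ‖w‖ → ‖w‖ < 1 → ‖F w‖ ≤ K * (‖1 - w‖ ^ 2)⁻¹) (n : ℕ) :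
    ‖a n‖ ≤ K * (n + 2) * Real.exp 1 := by
  have hn : (0 : ℝ) ≤ n := n.cast_nonneg
  set r : ℝ := (n + 1) / (n + 2) with hr
  have hr0 : 0 < r := by positivity
  have hr1 : r < 1 := by rw [hr, div_lt_one (by positivity)]; linarith
  have hr2 : 2⁻¹ ≤ r := by rw [hr, le_div_iff₀ (by positivity)]; linarith
  have h1 : (1 - r ^ 2)⁻¹ ≤ (n : ℝ) + 2 := by
    have h3 : ((n : ℝ) + 2)⁻¹ = 1 - r := by rw [hr]; field_simp; ring
    rw [inv_le_comm₀ (by nlinarith) (by positivity), h3]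
    nlinarith
  have h2 : r⁻¹ ^ n ≤ Real.exp 1 := by
    have h3 : r⁻¹ ≤ Real.exp ((n + 1 : ℝ)⁻¹) := by
      refine le_trans (le_of_eq ?_) (Real.add_one_le_exp _)
      rw [hr]; field_simp; ring
    calc r⁻¹ ^ n ≤ Real.exp ((n + 1 : ℝ)⁻¹) ^ n := by gcongr
      _ = Real.exp (n * (n + 1 : ℝ)⁻¹) := (Real.exp_nat_mul _ n).symm
      _ ≤ Real.exp 1 := by
        gcongr
        rw [← div_eq_mul_inv, div_le_one (by positivity)]
        linarith
  refine (norm_coeff_mul_pow_le_of_norm_le_div_norm_one_sub_sq hr0 hr1 hF hsum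
    (fun w hw => hK w (hw ▸ hr2) (hw ▸ hr1)) n).trans ?_
  gcongr

end Coefficients

section BanachAlgebra

variable {A : Type*} [NormedRing A] [NormedAlgebra ℂ A]

lemma isUnit_one_sub_smul_of_spectrum_subset {T : A} (hσ : spectrum ℂ T ⊆ closedBall 0 1)
    {w : ℂ} (hw : ‖w‖ < 1) : IsUnit (1 - w • T) := by
  rcases eq_or_ne w 0 with rfl | hw0
  · simp
  have h : w⁻¹ ∉ spectrum ℂ T := fun hmem => by
    have := hσ hmem
    rw [mem_closedBall_zero_iff, norm_inv] at this
    exact this.not_gt ((one_lt_inv₀ (norm_pos_iff.2 hw0)).2 hw)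
  rw [spectrum.notMem_iff] at h
  have h2 := h.smul (Units.mk0 w hw0)
  rwa [Units.smul_mk0, smul_sub, Algebra.algebraMap_eq_smul_one, smul_inv_smul₀ hw0] at h2

lemma resolvent_inv_eq_smul {T : A} {w : ℂ} (hw0 : w ≠ 0) :
    resolvent T w⁻¹ = w • Ring.inverse (1 - w • T) := by
  have h := spectrum.units_smul_resolvent_self (r := (Units.mk0 w hw0)⁻¹) (a := T)
  simp only [resolvent, Units.smul_def, Units.val_inv_eq_inv_val, Units.val_mk0, inv_inv, map_one]
    at h
  rw [← h, smul_inv_smul₀ hw0, resolvent]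

lemma norm_one_sub_mul_norm_inverse {T : A} {w : ℂ} (hw0 : w ≠ 0) :
    ‖1 - w‖ * ‖Ring.inverse (1 - w • T)‖ = ‖(w⁻¹ - 1) • resolvent T w⁻¹‖ := by
  rw [resolvent_inv_eq_smul hw0, smul_smul, sub_mul, inv_mul_cancel₀ hw0, one_mul, norm_smul]

lemma eventually_hasSum_choose_mul_pow [CompleteSpace A] (T : A) (k : ℕ) :
    ∀ᶠ w in 𝓝 (0 : ℂ), HasSum (fun n => w ^ n • (((n + k).choose k : ℂ) • T ^ n))
      (Ring.inverse (1 - w • T) ^ (k + 1)) := by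
  have hlim : Tendsto (fun w : ℂ => ‖w • T‖) (𝓝 0) (𝓝 0) := by
    have : Continuous fun w : ℂ => ‖w • T‖ := by fun_prop
    simpa using this.tendsto 0
  filter_upwards [hlim.eventually_lt_const one_pos] with w hw
  convert hasSum_choose_mul_geometric_of_norm_lt_one' k hw using 2 with n
  rw [smul_pow, smul_comm, mul_smul_comm, ← nsmul_eq_mul, Nat.cast_smul_eq_nsmul, smul_comm]

lemma differentiableOn_inverse_one_sub_smul_pow [CompleteSpace A] {T : A}
    (hσ : spectrum ℂ T ⊆ closedBall 0 1) (k : ℕ) :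
    DifferentiableOn ℂ (fun w : ℂ => Ring.inverse (1 - w • T) ^ k) (ball 0 1) := by
  intro w hw
  have hd : DifferentiableAt ℂ (fun w : ℂ => 1 - w • T) w := by fun_prop
  exact (((differentiableAt_inverse (𝕜 := ℂ) (isUnit_one_sub_smul_of_spectrum_subset hσ
    (mem_ball_zero_iff.1 hw))).comp w hd).pow k).differentiableWithinAt

lemma norm_inverse_one_sub_smul_le {T : A} {C : ℝ}
    (hC : ∀ z : ℂ, 1 < ‖z‖ → ‖(z - 1) • resolvent T z‖ ≤ C) {w : ℂ} (hw0 : w ≠ 0)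
    (hw : ‖w‖ < 1) :
    ‖Ring.inverse (1 - w • T)‖ ≤ C * ‖1 - w‖⁻¹ := by
  have hpos : 0 < ‖1 - w‖ := by
    refine norm_pos_iff.2 (sub_ne_zero.2 fun h => ?_)
    rw [← h, norm_one] at hw
    exact hw.false
  rw [← div_eq_mul_inv, le_div_iff₀ hpos, mul_comm, norm_one_sub_mul_norm_inverse hw0]
  refine hC _ ?_
  rw [norm_inv]
  exact (one_lt_inv₀ (norm_pos_iff.2 hw0)).2 hw

lemma norm_inverse_one_sub_smul_sq_le {T : A} {C : ℝ}
    (hC : ∀ z : ℂ, 1 < ‖z‖ → ‖(z - 1) • resolvent T z‖ ≤ C) {w : ℂ} (hw0 : w ≠ 0)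
    (hw : ‖w‖ < 1) :
    ‖Ring.inverse (1 - w • T) ^ 2‖ ≤ C ^ 2 * (‖1 - w‖ ^ 2)⁻¹ := by
  refine (norm_pow_le' _ two_pos).trans ?_
  rw [← inv_pow, ← mul_pow]
  exact pow_le_pow_left₀ (norm_nonneg _) (norm_inverse_one_sub_smul_le hC hw0 hw) 2

lemma norm_inverse_one_sub_smul_mul_sub_one_le {T : A} {C : ℝ}
    (hσ : spectrum ℂ T ⊆ closedBall 0 1)
    (hC : ∀ z : ℂ, 1 < ‖z‖ → ‖(z - 1) • resolvent T z‖ ≤ C) {w : ℂ} (hw0 : w ≠ 0)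
    (hw : ‖w‖ < 1) :
    ‖w‖ * ‖Ring.inverse (1 - w • T) * (T - 1)‖ ≤ C + ‖(1 : A)‖ := by
  have hinv := Ring.inverse_mul_cancel _ (isUnit_one_sub_smul_of_spectrum_subset hσ hw)
  have h : w • (Ring.inverse (1 - w • T) * (T - 1)) =
      (1 - w) • Ring.inverse (1 - w • T) - 1 := by
    have h2 : w • (T - 1) = (1 - w) • (1 : A) - (1 - w • T) := by
      rw [smul_sub, sub_smul, one_smul]; abel
    rw [← mul_smul_comm, h2, mul_sub, hinv, mul_smul_comm, mul_one]
  rw [← norm_smul, h]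
  refine (norm_sub_le _ _).trans (add_le_add_left ?_ _)
  rw [norm_smul, norm_one_sub_mul_norm_inverse hw0]
  refine hC _ ?_
  rw [norm_inv]
  exact (one_lt_inv₀ (norm_pos_iff.2 hw0)).2 hw

theorem exists_norm_pow_le_of_resolvent_bound [CompleteSpace A] {T : A} {C : ℝ}
    (hσ : spectrum ℂ T ⊆ closedBall 0 1)
    (hC : ∀ z : ℂ, 1 < ‖z‖ → ‖(z - 1) • resolvent T z‖ ≤ C) :
    ∃ M : ℝ, ∀ n : ℕ, ‖T ^ n‖ ≤ M := by
  refine ⟨2 * C ^ 2 * Real.exp 1, fun n => ?_⟩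
  have h := norm_coeff_le_of_norm_le_div_norm_one_sub_sq (K := C ^ 2) (by positivity)
    (differentiableOn_inverse_one_sub_smul_pow hσ 2) (eventually_hasSum_choose_mul_pow T 1)
    (fun w hw hw1 => norm_inverse_one_sub_smul_sq_le hC
      (norm_pos_iff.1 (lt_of_lt_of_le (by norm_num) hw)) hw1) n
  rw [norm_smul, Nat.choose_one_right, Complex.norm_natCast, Nat.cast_add, Nat.cast_one] at h
  have hn : (0 : ℝ) ≤ n := n.cast_nonneg
  have hpos : 0 ≤ C ^ 2 * Real.exp 1 := by positivity
  have : ((n : ℝ) + 1) * ‖T ^ n‖ ≤ (n + 1) * (2 * C ^ 2 * Real.exp 1) :=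
    h.trans (by nlinarith)
  exact le_of_mul_le_mul_left this (by positivity)

theorem exists_norm_pow_mul_sub_one_le_of_resolvent_bound [CompleteSpace A] {T : A} {C : ℝ}
    (hσ : spectrum ℂ T ⊆ closedBall 0 1)
    (hC : ∀ z : ℂ, 1 < ‖z‖ → ‖(z - 1) • resolvent T z‖ ≤ C) :
    ∃ M : ℝ, ∀ n : ℕ, (n + 1) * ‖T ^ n * (T - 1)‖ ≤ M := by
  have hC0 : 0 ≤ C := (norm_nonneg _).trans (hC 2 (by norm_num))
  refine ⟨2 * (C ^ 2 * (2 * (C + ‖(1 : A)‖))) * Real.exp 1, fun n => ?_⟩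
  have h := norm_coeff_le_of_norm_le_div_norm_one_sub_sq (K := C ^ 2 * (2 * (C + ‖(1 : A)‖)))
    (a := fun n => ((n + 2).choose 2 : ℂ) • (T ^ n * (T - 1)))
    (F := fun w => Ring.inverse (1 - w • T) ^ 3 * (T - 1)) (by positivity)
    ((differentiableOn_inverse_one_sub_smul_pow hσ 3).mul_const _) ?_ ?_ n
  · have hch : (((n + 2).choose 2 : ℕ) : ℝ) = (n + 2) * (n + 1) / 2 := by
      rw [Nat.cast_choose_two]; push_cast; ring
    rw [norm_smul, Complex.norm_natCast, hch] at h
    refine le_of_mul_le_mul_left ?_ (by positivity : (0 : ℝ) < (n + 2) / 2)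
    linarith
  · filter_upwards [eventually_hasSum_choose_mul_pow T 2] with w hw
    simpa only [smul_mul_assoc] using hw.mul_right (T - 1)
  · intro w hw hw1
    have hw0 : w ≠ 0 := norm_pos_iff.1 (lt_of_lt_of_le (by norm_num) hw)
    have h1 := norm_inverse_one_sub_smul_sq_le hC hw0 hw1
    have h2 : ‖Ring.inverse (1 - w • T) * (T - 1)‖ ≤ 2 * (C + ‖(1 : A)‖) := by
      have h3 := norm_inverse_one_sub_smul_mul_sub_one_le hσ hC hw0 hw1
      nlinarith [norm_nonneg (Ring.inverse (1 - w • T) * (T - 1))]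
    rw [pow_succ, mul_assoc, mul_right_comm]
    exact (norm_mul_le _ _).trans (mul_le_mul h1 h2 (norm_nonneg _) (by positivity))

lemma spectrum_subset_closedBall_of_norm_pow_le [CompleteSpace A] {T : A} {M : ℝ}
    (hM : ∀ n : ℕ, ‖T ^ n‖ ≤ M) : spectrum ℂ T ⊆ closedBall 0 1 := by
  intro z hz
  rw [mem_closedBall_zero_iff]
  by_contra! h
  obtain ⟨n, hn⟩ := pow_unbounded_of_one_lt (M * ‖(1 : A)‖) h
  have h1 := spectrum.norm_le_norm_mul_of_mem (spectrum.pow_mem_pow T n hz)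
  rw [norm_pow] at h1
  exact (hn.trans_le h1).not_ge (mul_le_mul_of_nonneg_right (hM n) (norm_nonneg _))

/-- Some power of `w` of order comparable to `‖1 - w‖⁻¹` is far from `1`. -/
lemma exists_half_le_norm_one_sub_pow {w : ℂ} (hw : ‖w‖ ≤ 1) (hw1 : w ≠ 1) :
    ∃ L : ℕ, L * ‖1 - w‖ ≤ 3 ∧ 1 / 2 ≤ ‖1 - w ^ L‖ := by
  have hpos : 0 < ‖1 - w‖ := norm_pos_iff.2 (sub_ne_zero.2 hw1.symm)
  have htwo : ‖1 - w‖ ≤ 2 := by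
    have := norm_sub_le 1 w
    rw [norm_one] at this
    linarith
  by_contra! hcon
  set N : ℕ := ⌈‖1 - w‖⁻¹⌉₊ with hN
  have hN1 : 1 ≤ N * ‖1 - w‖ := by
    rw [← div_le_iff₀ hpos, one_div]
    exact Nat.le_ceil _
  have hN3 : N * ‖1 - w‖ ≤ 3 := by
    have := (Nat.ceil_lt_add_one (inv_nonneg.2 hpos.le)).le
    calc N * ‖1 - w‖ ≤ (‖1 - w‖⁻¹ + 1) * ‖1 - w‖ := by gcongr
      _ = 1 + ‖1 - w‖ := by rw [add_mul, inv_mul_cancel₀ hpos.ne', one_mul]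
      _ ≤ 3 := by linarith
  have hclose (k : ℕ) (hk : k ≤ N) : ‖1 - w ^ k‖ < 1 / 2 :=
    hcon k (le_trans (by gcongr) hN3)
  have hsum : ‖(N : ℂ) - ∑ k ∈ Finset.range N, w ^ k‖ ≤ N * (1 / 2) := by
    have : (N : ℂ) - ∑ k ∈ Finset.range N, w ^ k = ∑ k ∈ Finset.range N, (1 - w ^ k) := by
      simp
    rw [this]
    refine (norm_sum_le_of_le _ fun k hk => (hclose k (Finset.mem_range.1 hk).le).le).trans ?_
    simp
  have hgeom : ‖∑ k ∈ Finset.range N, w ^ k‖ * ‖1 - w‖ < 1 / 2 := by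
    rw [← norm_mul, geom_sum_mul_neg]
    exact hclose N le_rfl
  have hlow : (N : ℝ) * (1 / 2) ≤ ‖∑ k ∈ Finset.range N, w ^ k‖ := by
    have h1 := norm_sub_norm_le (N : ℂ) (∑ k ∈ Finset.range N, w ^ k)
    rw [Complex.norm_natCast] at h1
    linarith
  nlinarith

lemma norm_pow_sub_pow_add_le {R : Type*} [NormedRing R] {T : R} {K : ℝ}
    (hK : ∀ n : ℕ, (n + 1) * ‖T ^ n * (T - 1)‖ ≤ K) (N L : ℕ) :
    N * ‖T ^ (N + L) - T ^ N‖ ≤ L * K := by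
  have hK0 : 0 ≤ K := le_trans (by positivity) (hK 0)
  have htel : T ^ (N + L) - T ^ N = ∑ k ∈ Finset.range L, T ^ (N + k) * (T - 1) := by
    refine (Finset.sum_range_sub (fun k => T ^ (N + k)) L).symm.trans
      (Finset.sum_congr rfl fun k _ => ?_)
    rw [mul_sub, mul_one, ← pow_succ, add_assoc]
  calc N * ‖T ^ (N + L) - T ^ N‖
      ≤ N * ∑ k ∈ Finset.range L, ‖T ^ (N + k) * (T - 1)‖ := by
        rw [htel]; gcongr; exact norm_sum_le _ _
    _ = ∑ k ∈ Finset.range L, N * ‖T ^ (N + k) * (T - 1)‖ := Finset.mul_sum _ _ _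
    _ ≤ ∑ _k ∈ Finset.range L, K := by
        refine Finset.sum_le_sum fun k _ => le_trans ?_ (hK (N + k))
        gcongr
        push_cast
        linarith [k.cast_nonneg (α := ℝ)]
    _ = L * K := by simp

lemma norm_geom_sum_smul_le {T : A} {M : ℝ} (hM : ∀ n : ℕ, ‖T ^ n‖ ≤ M) {w : ℂ}
    (hw : ‖w‖ ≤ 1) (N n : ℕ) :
    ‖(w • T) ^ n * ∑ k ∈ Finset.range N, (w • T) ^ k‖ ≤ N * M := by
  rw [Finset.mul_sum]
  refine (norm_sum_le_of_le _ (f := fun k => (w • T) ^ n * (w • T) ^ k) (n := fun _ => M)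
    fun k _ => ?_).trans (by simp)
  rw [← pow_add, smul_pow, norm_smul, norm_pow]
  exact (mul_le_of_le_one_left (norm_nonneg _) (pow_le_one₀ (norm_nonneg _) hw)).trans (hM _)

theorem exists_norm_one_sub_mul_norm_le_of_norm_pow_le {T : A} {M K : ℝ}
    (hM : ∀ n : ℕ, ‖T ^ n‖ ≤ M) (hK : ∀ n : ℕ, (n + 1) * ‖T ^ n * (T - 1)‖ ≤ K) :
    ∃ C : ℝ, ∀ (w : ℂ) (f : A), ‖w‖ < 1 → (1 - w • T) * f = 1 → ‖1 - w‖ * ‖f‖ ≤ C := by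
  have hM0 : 0 ≤ M := (norm_nonneg _).trans (hM 0)
  obtain ⟨p, hp⟩ := exists_nat_gt (max (4 * K) 0)
  rw [max_lt_iff] at hp
  refine ⟨6 * (p * M + 2 * M), fun w f hw hf => ?_⟩
  have hw1 : w ≠ 1 := fun h => by rw [h, norm_one] at hw; exact hw.false
  obtain ⟨L, hL3, hL⟩ := exists_half_le_norm_one_sub_pow hw.le hw1
  have hLpos : (0 : ℝ) < L := by
    rcases L.eq_zero_or_pos with rfl | h
    · norm_num at hL
    · exact_mod_cast h
  have hgeom (n : ℕ) : f = ∑ k ∈ Finset.range n, (w • T) ^ k + (w • T) ^ n * f := by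
    have h := congrArg (· * f) (geom_sum_mul_neg (w • T) n)
    simp only [mul_assoc, hf, mul_one, sub_mul, one_mul] at h
    rw [h, sub_add_cancel]
  set N : ℕ := p * L with hN
  have hdiff : ‖T ^ (N + L) - T ^ N‖ ≤ 1 / 4 := by
    have h := norm_pow_sub_pow_add_le hK N L
    rw [hN] at h ⊢
    push_cast at h
    have h2 : (p : ℝ) * ‖T ^ (p * L + L) - T ^ (p * L)‖ ≤ K :=
      le_of_mul_le_mul_left (by linarith) hLpos
    refine le_of_mul_le_mul_left (h2.trans ?_) hp.2
    linarith
  have hkey : (1 - w ^ L) • ((w • T) ^ N * f) =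
      (w • T) ^ N * ∑ k ∈ Finset.range L, (w • T) ^ k +
        w ^ (N + L) • ((T ^ (N + L) - T ^ N) * f) := by
    have h1 : (w • T) ^ N * f = (w • T) ^ N * ∑ k ∈ Finset.range L, (w • T) ^ k +
        (w • T) ^ (N + L) * f := by
      conv_lhs => rw [hgeom L]
      rw [mul_add, ← mul_assoc, ← pow_add]
    have h2 : w ^ L • ((w • T) ^ N * f) = w ^ (N + L) • (T ^ N * f) := by
      rw [smul_pow, smul_mul_assoc, smul_smul, pow_add, mul_comm]
    rw [sub_smul, one_smul, h2, sub_mul, smul_sub, h1, smul_pow w T (N + L), smul_mul_assoc]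
    abel
  have htail : ‖(w • T) ^ N * f‖ ≤ 2 * (L * M + 1 / 4 * ‖f‖) := by
    have h1 : ‖(1 - w ^ L) • ((w • T) ^ N * f)‖ ≤ L * M + 1 / 4 * ‖f‖ := by
      rw [hkey]
      refine (norm_add_le _ _).trans (add_le_add (norm_geom_sum_smul_le hM hw.le L N) ?_)
      rw [norm_smul, norm_pow]
      refine (mul_le_of_le_one_left (norm_nonneg _) (pow_le_one₀ (norm_nonneg _) hw.le)).trans ?_
      exact (norm_mul_le _ _).trans (by gcongr)
    rw [norm_smul] at h1
    nlinarith [norm_nonneg ((w • T) ^ N * f)]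
  have hf_le : ‖f‖ ≤ 2 * (p * M + 2 * M) * L := by
    have h1 : ‖f‖ ≤ N * M + 2 * (L * M + 1 / 4 * ‖f‖) := by
      conv_lhs => rw [hgeom N]
      refine (norm_add_le _ _).trans (add_le_add ?_ htail)
      simpa using norm_geom_sum_smul_le hM hw.le N 0
    rw [hN] at h1
    push_cast at h1
    nlinarith
  calc ‖1 - w‖ * ‖f‖ ≤ ‖1 - w‖ * (2 * (p * M + 2 * M) * L) := by gcongr
    _ = (L * ‖1 - w‖) * (2 * (p * M + 2 * M)) := by ring
    _ ≤ 3 * (2 * (p * M + 2 * M)) := by gcongr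
    _ = 6 * (p * M + 2 * M) := by ring

theorem exists_resolvent_bound_of_norm_pow_le [CompleteSpace A] {T : A} {M K : ℝ}
    (hM : ∀ n : ℕ, ‖T ^ n‖ ≤ M) (hK : ∀ n : ℕ, (n + 1) * ‖T ^ n * (T - 1)‖ ≤ K) :
    ∃ C : ℝ, ∀ z : ℂ, 1 < ‖z‖ → ‖(z - 1) • resolvent T z‖ ≤ C := by
  obtain ⟨C, hC⟩ := exists_norm_one_sub_mul_norm_le_of_norm_pow_le hM hK
  refine ⟨C, fun z hz => ?_⟩
  have hz0 : z ≠ 0 := norm_pos_iff.1 (one_pos.trans hz)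
  have hw : ‖z⁻¹‖ < 1 := by rw [norm_inv]; exact inv_lt_one_of_one_lt₀ hz
  have hunit := isUnit_one_sub_smul_of_spectrum_subset
    (spectrum_subset_closedBall_of_norm_pow_le hM) hw
  have h := norm_one_sub_mul_norm_inverse (T := T) (inv_ne_zero hz0)
  rw [inv_inv] at h
  rw [← h]
  exact hC _ _ hw (Ring.mul_inverse_cancel _ hunit)

end BanachAlgebra

/-- Characterization of Tadmor–Ritt operators: `T` is Tadmor–Ritt (spectrum in the
closed unit disc and `sup_{|z|>1} ‖(z-1)(zI-T)⁻¹‖ < ∞`) if and only if both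
`sup_n ‖Tⁿ‖ < ∞` and `sup_{n ≥ 1} ‖n(Tⁿ - Tⁿ⁻¹)‖ < ∞`. -/
theorem tadmorRitt_iff_powerBounded_and_diffBounded
    {X : Type*} [NormedAddCommGroup X] [NormedSpace ℂ X] [CompleteSpace X]
    (T : X →L[ℂ] X) :
    (spectrum ℂ T ⊆ Metric.closedBall (0 : ℂ) 1 ∧
      ∃ C : ℝ, ∀ z : ℂ, 1 < ‖z‖ → ‖(z - 1) • resolvent T z‖ ≤ C) ↔
    ((∃ M : ℝ, ∀ n : ℕ, ‖T ^ n‖ ≤ M) ∧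
      (∃ M' : ℝ, ∀ n : ℕ, 1 ≤ n → ‖(n : ℝ) • (T ^ n - T ^ (n - 1))‖ ≤ M')) := by
  have hdiff (n : ℕ) : ‖((n + 1 : ℕ) : ℝ) • (T ^ (n + 1) - T ^ (n + 1 - 1))‖ =
      (n + 1) * ‖T ^ n * (T - 1)‖ := by
    rw [norm_smul, Real.norm_natCast, Nat.add_sub_cancel, mul_sub, mul_one, pow_succ]
    push_cast
    rfl
  constructor
  · rintro ⟨hσ, C, hC⟩
    obtain ⟨K, hK⟩ := exists_norm_pow_mul_sub_one_le_of_resolvent_bound hσ hC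
    refine ⟨exists_norm_pow_le_of_resolvent_bound hσ hC, K, fun n hn => ?_⟩
    obtain ⟨m, rfl⟩ := Nat.exists_eq_add_of_le' hn
    exact (hdiff m).trans_le (hK m)
  · rintro ⟨⟨M, hM⟩, K, hK⟩
    exact ⟨spectrum_subset_closedBall_of_norm_pow_le hM,
      exists_resolvent_bound_of_norm_pow_le hM
        fun n => (hdiff n).symm.trans_le (hK (n + 1) (Nat.le_add_left 1 n))⟩
end

section
/- Let X be a complex Banach space and T a bounded linear operator on X whose spectrum is contained in the closed unit disc and which satisfies ‖(z−1)(zI−T)⁻¹‖ ≤ C for all |z| > 1, with C ≥ 1. Fix s ∈ (0,1) and set a = 2e/(π(1−s)) and b = −2 log s + 6. Then T is power-bounded with sup_{n ∈ ℕ} ‖Tⁿ‖ ≤ a·C·(2 log C + b). -/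
open Real Metric

/-- One integration by parts, away from the endpoint `0`, replaces a logarithmic dependence on the
frequency `N` by a logarithmic dependence on `C`. -/
theorem norm_integral_zero_pi_le_of_hasDerivAt {E : Type*} [NormedAddCommGroup E]
    [NormedSpace ℂ E] [CompleteSpace E] {H K : ℝ → E} (hH : Continuous H) (hK : Continuous K)
    {c : ℂ} (hc : ‖c‖ = 1) {N M C : ℝ} (hN : 2 ≤ N) (hM : 0 ≤ M) (hC : 1 ≤ C)
    (hder : ∀ θ, HasDerivAt H (c • ((N : ℂ) • H θ - K θ)) θ)
    (hHN : ∀ θ, ‖H θ‖ ≤ M * C * N)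
    (hHθ : ∀ θ, 0 < θ → θ ≤ π → ‖H θ‖ ≤ M * C * (5 / 2) * (1 / θ))
    (hKθ : ∀ θ, 0 < θ → θ ≤ π → ‖K θ‖ ≤ M * C ^ 2 * (25 / 4) * θ ^ (-2 : ℤ)) :
    ‖∫ θ in (0 : ℝ)..π, H θ‖ ≤ M * C * (12 + 4 * log C) := by
  have hMC : 0 ≤ M * C := by positivity
  have hN0 : 0 < N := by linarith
  have hlog : 0 ≤ log C := log_nonneg hC
  have near : ∀ b, 1 / N ≤ b → b ≤ π →
      ‖∫ θ in (0 : ℝ)..b, H θ‖ ≤ M * C * (1 + 5 / 2 * log (b * N)) := by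
    intro b hb hbπ
    have hNi : 0 < 1 / N := by positivity
    have hb0 : 0 < b := by linarith
    rw [← intervalIntegral.integral_add_adjacent_intervals (hH.intervalIntegrable 0 (1 / N))
      (hH.intervalIntegrable (1 / N) b)]
    have h1 : ‖∫ θ in (0 : ℝ)..(1 / N), H θ‖ ≤ M * C * N * |1 / N - 0| :=
      intervalIntegral.norm_integral_le_of_norm_le_const fun θ _ => hHN θ
    have h2 : ‖∫ θ in (1 / N)..b, H θ‖ ≤ ∫ θ in (1 / N)..b, M * C * (5 / 2) * (1 / θ) := by
      refine intervalIntegral.norm_integral_le_of_norm_le hb (.of_forall fun θ hθ => ?_) ?_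
      · exact hHθ θ (hNi.trans hθ.1) (hθ.2.trans hbπ)
      · refine (intervalIntegral.intervalIntegrable_one_div (fun θ hθ => ?_)
          continuousOn_id).const_mul _
        rw [Set.uIcc_of_le hb] at hθ
        exact (hNi.trans_le hθ.1).ne'
    rw [intervalIntegral.integral_const_mul, integral_one_div_of_pos hNi hb0] at h2
    have e1 : b / (1 / N) = b * N := by field_simp
    rw [e1] at h2
    have e2 : M * C * N * |1 / N - 0| = M * C := by
      rw [sub_zero, abs_of_pos hNi]; field_simp
    rw [e2] at h1
    refine (norm_add_le _ _).trans ?_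
    linarith
  by_cases hCN : C / N ≤ π
  · set b := C / N with hb
    have hb0 : 0 < b := by positivity
    have hbN : b * N = C := by rw [hb]; field_simp
    have hfar : N * ‖∫ θ in b..π, H θ‖ ≤
        M * C * (5 / 2) * (1 / b + 1 / π) + M * C ^ 2 * (25 / 4) * (1 / b - 1 / π) := by
      have hI := intervalIntegral.integral_eq_sub_of_hasDerivAt (a := b) (b := π)
        (fun θ _ => hder θ)
        (((hH.const_smul (N : ℂ)).sub hK).const_smul c |>.intervalIntegrable _ _)
      rw [intervalIntegral.integral_smul, intervalIntegral.integral_sub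
        (f := fun θ => (N : ℂ) • H θ) ((hH.const_smul (N : ℂ)).intervalIntegrable _ _)
        (hK.intervalIntegrable _ _),
        intervalIntegral.integral_smul] at hI
      have hKint : ‖∫ θ in b..π, K θ‖ ≤ M * C ^ 2 * (25 / 4) * (1 / b - 1 / π) := by
        have h2 : ‖∫ θ in b..π, K θ‖ ≤ ∫ θ in b..π, M * C ^ 2 * (25 / 4) * θ ^ (-2 : ℤ) := by
          refine intervalIntegral.norm_integral_le_of_norm_le hCN (.of_forall fun θ hθ => ?_) ?_
          · exact hKθ θ (hb0.trans hθ.1) hθ.2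
          · refine (intervalIntegral.intervalIntegrable_zpow (.inr ?_)).const_mul _
            rw [Set.uIcc_of_le hCN]
            exact fun h => hb0.not_ge h.1
        rw [intervalIntegral.integral_const_mul, integral_zpow (.inr ⟨by norm_num, by
          rw [Set.uIcc_of_le hCN]; exact fun h => hb0.not_ge h.1⟩)] at h2
        convert h2 using 2
        norm_num [zpow_neg]
        ring
      have hsm : (N : ℂ) • ∫ θ in b..π, H θ =
          c⁻¹ • (H π - H b) + ∫ θ in b..π, K θ := by
        have hc0 : c ≠ 0 := by rintro rfl; simp at hc
        rw [← hI, inv_smul_smul₀ hc0]; abel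
      calc N * ‖∫ θ in b..π, H θ‖ = ‖(N : ℂ) • ∫ θ in b..π, H θ‖ := by
            rw [norm_smul, Complex.norm_real, norm_of_nonneg hN0.le]
        _ ≤ ‖H π‖ + ‖H b‖ + ‖∫ θ in b..π, K θ‖ := by
            rw [hsm]
            refine (norm_add_le _ _).trans ?_
            gcongr
            rw [norm_smul, norm_inv, hc, inv_one, one_mul]
            exact norm_sub_le _ _
        _ ≤ _ := by
            have := hHθ π pi_pos le_rfl
            have := hHθ b hb0 hCN
            linarith
    have hfar' : ‖∫ θ in b..π, H θ‖ ≤ M * C * 10 := by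
      refine le_of_mul_le_mul_left (hfar.trans ?_) hN0
      have hπi : 1 / π ≤ 1 / 3 := by
        gcongr; exact pi_gt_three.le
      have hπ0 : 0 ≤ 1 / π := by positivity
      have hbi : C * (1 / b) = N := by rw [hb]; field_simp
      have hbi' : 1 / b ≤ N := by rw [← hbi]; exact le_mul_of_one_le_left (by positivity) hC
      have : M * C ^ 2 * (25 / 4) * (1 / b - 1 / π) ≤ M * C * (25 / 4) * N := by
        rw [← hbi]
        have : 0 ≤ M * C ^ 2 * (25 / 4) * (1 / π) := by positivity
        nlinarith
      nlinarith
    have hnear := near b (by rw [hb]; gcongr) hCN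
    rw [hbN] at hnear
    rw [← intervalIntegral.integral_add_adjacent_intervals (hH.intervalIntegrable 0 b)
      (hH.intervalIntegrable b π)]
    refine (norm_add_le _ _).trans ?_
    nlinarith [mul_nonneg hMC hlog]
  · rw [not_le, lt_div_iff₀ hN0] at hCN
    have hle : 1 / N ≤ π := by
      rw [div_le_iff₀ hN0]; nlinarith [pi_gt_three]
    refine (near π hle le_rfl).trans ?_
    have : log (π * N) ≤ log C := log_le_log (by positivity) hCN.le
    refine mul_le_mul_of_nonneg_left ?_ hMC
    linarith

theorem norm_circleMap_sub_one_sq (r θ : ℝ) :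
    ‖circleMap 0 r θ - 1‖ ^ 2 = (r - 1) ^ 2 + 2 * r * (1 - cos θ) := by
  rw [← Complex.normSq_eq_norm_sq, Complex.normSq_apply]
  simp only [circleMap, zero_add, Complex.exp_mul_I, ← Complex.ofReal_cos, ← Complex.ofReal_sin]
  simp only [Complex.sub_re, Complex.sub_im, Complex.mul_re, Complex.mul_im, Complex.add_re,
    Complex.add_im, Complex.ofReal_re, Complex.ofReal_im, Complex.I_re, Complex.I_im,
    Complex.one_re, Complex.one_im]
  linear_combination r ^ 2 * sin_sq_add_cos_sq θ

theorem mul_abs_le_norm_circleMap_sub_one {r θ : ℝ} (h1 : 1 ≤ r) (h2 : r ≤ 2) (hθ : |θ| ≤ π) :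
    r * (2 / 5 * |θ|) ≤ ‖circleMap 0 r θ - 1‖ := by
  refine le_of_sq_le_sq ?_ (norm_nonneg _)
  have hcos := cos_le_one_sub_mul_cos_sq hθ
  have hπ : 4 / 25 ≤ 2 / π ^ 2 := by
    rw [div_le_div_iff₀ (by norm_num) (by positivity)]
    nlinarith [pi_lt_d2, pi_pos]
  calc (r * (2 / 5 * |θ|)) ^ 2 = r * r * (4 / 25 * θ ^ 2) := by rw [mul_pow, mul_pow, sq_abs]; ring
    _ ≤ 2 * r * (2 / π ^ 2 * θ ^ 2) := by gcongr
    _ ≤ 2 * r * (1 - cos θ) := by gcongr; linarith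
    _ ≤ (r - 1) ^ 2 + 2 * r * (1 - cos θ) := le_add_of_nonneg_left (sq_nonneg _)
    _ = ‖circleMap 0 r θ - 1‖ ^ 2 := (norm_circleMap_sub_one_sq r θ).symm

section resolvent

variable {A : Type*} [NormedRing A] [NormedAlgebra ℂ A]

theorem smul_resolvent_eq_inverse_one_sub (a : A) {z : ℂ} (hz : z ≠ 0) :
    z • resolvent a z = Ring.inverse (1 - z⁻¹ • a) := by
  have := spectrum.units_smul_resolvent_self (r := Units.mk0 z hz) (a := a)
  simpa [resolvent, Units.smul_def] using this

variable [CompleteSpace A]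

/-- Cauchy's formula for the powers of `a`, on a circle surrounding the spectrum. -/
theorem two_pi_smul_pow_eq_integral_resolvent {a : A} {r : ℝ} (hr : 0 < r)
    (ha : spectralRadius ℂ a < ENNReal.ofReal r) (n : ℕ) :
    (2 * π : ℂ) • a ^ n =
      ∫ θ in (-π)..π, circleMap 0 r θ ^ (n + 1) • resolvent a (circleMap 0 r θ) := by
  have hρ : 0 < r⁻¹ := inv_pos.2 hr
  have hlt : ((r⁻¹.toNNReal : NNReal) : ENNReal) < (spectralRadius ℂ a)⁻¹ := by
    rw [← ENNReal.ofReal, ENNReal.ofReal_inv_of_pos hr]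
    exact ENNReal.inv_lt_inv.2 ha
  have h₁ := (spectrum.differentiableOn_inverse_one_sub_smul hlt).hasFPowerSeriesOnBall
    (by simpa using hr)
  have h₂ := spectrum.hasFPowerSeriesOnBall_inverse_one_sub_smul ℂ a
  have h₃ := congrFun (h₂.hasFPowerSeriesAt.eq_formalMultilinearSeries h₁.hasFPowerSeriesAt) n
  have h₄ := congrArg (fun p => p fun _ => (1 : ℂ)) h₃
  simp only [cauchyPowerSeries_apply, ContinuousMultilinearMap.mkPiRing_apply, Finset.prod_const_one,
    one_smul, Real.coe_toNNReal _ hρ.le] at h₄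
  have h₅ : (∮ z in C(0, r⁻¹), (1 / (z - 0)) ^ n • (z - 0)⁻¹ • Ring.inverse (1 - z • a)) =
      Complex.I • ∫ θ in (0 : ℝ)..2 * π,
        circleMap 0 r (-θ) ^ (n + 1) • resolvent a (circleMap 0 r (-θ)) := by
    rw [circleIntegral, ← intervalIntegral.integral_smul]
    refine intervalIntegral.integral_congr fun θ _ => ?_
    have hinv : (circleMap 0 r (-θ))⁻¹ = circleMap 0 r⁻¹ θ := by
      rw [circleMap_zero_inv, neg_neg]
    have h0 : circleMap 0 r (-θ) ≠ 0 := circleMap_ne_center hr.ne'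
    simp only [deriv_circleMap, sub_zero]
    rw [← hinv, ← smul_resolvent_eq_inverse_one_sub a h0]
    simp only [smul_smul, one_div, inv_inv]
    congr 1
    field_simp
    ring
  rw [h₄, h₅, smul_smul, smul_smul,
    intervalIntegral.integral_comp_neg
      (fun θ => circleMap 0 r θ ^ (n + 1) • resolvent a (circleMap 0 r θ))]
  have hper : Function.Periodic
      (fun θ => circleMap 0 r θ ^ (n + 1) • resolvent a (circleMap 0 r θ)) (2 * π) := fun θ => by
    simp only [periodic_circleMap 0 r θ]
  have h₆ := hper.intervalIntegral_add_eq (-(2 * π)) (-π)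
  rw [show -(2 * π) + 2 * π = -0 by ring, show -π + 2 * π = π by ring] at h₆
  rw [h₆]
  convert one_smul ℂ _
  have : (π : ℂ) ≠ 0 := by exact_mod_cast pi_ne_zero
  field_simp

theorem hasDerivAt_circleMap_pow_smul_resolvent {a : A} {r ε θ : ℝ} (n : ℕ)
    (h : circleMap 0 r (ε * θ) ∈ resolventSet ℂ a) :
    HasDerivAt (fun θ : ℝ => circleMap 0 r (ε * θ) ^ (n + 1) • resolvent a (circleMap 0 r (ε * θ)))
      ((ε * Complex.I) • (((n + 1 : ℝ) : ℂ) •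
        circleMap 0 r (ε * θ) ^ (n + 1) • resolvent a (circleMap 0 r (ε * θ)) -
        circleMap 0 r (ε * θ) ^ (n + 2) • resolvent a (circleMap 0 r (ε * θ)) ^ 2)) θ := by
  have hz : HasDerivAt (fun θ : ℝ => circleMap 0 r (ε * θ))
      (ε * Complex.I * circleMap 0 r (ε * θ)) θ := by
    have := (hasDerivAt_circleMap 0 r (ε * θ)).scomp θ ((hasDerivAt_id θ).const_mul ε)
    convert! this using 1
    simp; ring
  have hzn := hz.fun_pow (n + 1)
  have hR := (spectrum.hasDerivAt_resolvent_const_left h).scomp θ hz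
  convert! hzn.fun_smul hR using 1
  simp only [Function.comp, add_tsub_cancel_right]
  push_cast
  module

/-- An element of a Banach algebra whose resolvent satisfies the Tadmor–Ritt condition is
power-bounded, with a bound of order `C log C`. -/
theorem norm_pow_le_of_norm_resolvent_le {a : A} {C : ℝ} (hC : 1 ≤ C)
    (hspec : spectrum ℂ a ⊆ closedBall (0 : ℂ) 1)
    (hres : ∀ z : ℂ, 1 < ‖z‖ → ‖(z - 1) • resolvent a z‖ ≤ C) {n : ℕ} (hn : n ≠ 0) :
    ‖a ^ n‖ ≤ exp 1 / π * C * (12 + 4 * log C) := by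
  have hn1 : (1 : ℝ) ≤ n := by exact_mod_cast Nat.one_le_iff_ne_zero.2 hn
  have hn0 : (0 : ℝ) < n := by linarith
  set r : ℝ := 1 + 1 / n with hr
  have hr1 : 1 < r := by rw [hr]; simp [hn0]
  have hr0 : 0 < r := by linarith
  have hr2 : r ≤ 2 := by
    have : 1 / (n : ℝ) ≤ 1 := by rw [div_le_one hn0]; exact hn1
    linarith
  have hrn : r ^ n ≤ exp 1 := by
    calc r ^ n ≤ (exp (1 / n)) ^ n := by
          gcongr; rw [hr, add_comm]; exact add_one_le_exp _
      _ = exp 1 := by rw [← exp_nat_mul]; congr 1; field_simp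
  have hrN : 1 / (r - 1) * r = n + 1 := by rw [hr]; field_simp; ring
  have hnz : ∀ θ, ‖circleMap 0 r θ‖ = r := fun θ => by
    rw [norm_circleMap_zero, abs_of_pos hr0]
  have hmem : ∀ θ, circleMap 0 r θ ∈ resolventSet ℂ a := fun θ => by
    by_contra h
    have := hspec h
    rw [mem_closedBall_zero_iff, hnz] at this
    linarith
  have hsr : spectralRadius ℂ a < ENNReal.ofReal r := by
    refine lt_of_le_of_lt (b := 1) (iSup₂_le fun k hk => ?_) (by simpa using hr1)
    have := mem_closedBall_zero_iff.1 (hspec hk)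
    exact_mod_cast this
  have hz1 : ∀ θ, r - 1 ≤ ‖circleMap 0 r θ - 1‖ := fun θ => by
    simpa [hnz] using norm_sub_norm_le (circleMap 0 r θ) 1
  have hR : ∀ θ d, 0 < d → d ≤ ‖circleMap 0 r θ - 1‖ →
      ‖resolvent a (circleMap 0 r θ)‖ ≤ C / d := fun θ d hd hdle => by
    rw [le_div_iff₀ hd, mul_comm]
    have := hres (circleMap 0 r θ) (by rwa [hnz])
    rw [norm_smul] at this
    exact (mul_le_mul_of_nonneg_right hdle (norm_nonneg _)).trans this
  have half : ∀ ε : ℝ, |ε| = 1 →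
      ‖∫ θ in (0 : ℝ)..π, circleMap 0 r (ε * θ) ^ (n + 1) • resolvent a (circleMap 0 r (ε * θ))‖ ≤
        exp 1 * C * (12 + 4 * log C) := by
    intro ε hε
    have hRc : Continuous fun θ : ℝ => resolvent a (circleMap 0 r (ε * θ)) :=
      continuous_iff_continuousAt.2 fun θ =>
        (spectrum.hasDerivAt_resolvent_const_left (hmem (ε * θ))).continuousAt.comp
          (f := fun θ : ℝ => circleMap 0 r (ε * θ)) (by fun_prop)
    have hzc : Continuous fun θ : ℝ => circleMap 0 r (ε * θ) := by fun_prop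
    have hRθ : ∀ θ, 0 < θ → θ ≤ π →
        ‖resolvent a (circleMap 0 r (ε * θ))‖ ≤ C / (r * (2 / 5 * θ)) := fun θ h0 hπ => by
      refine hR _ _ (by positivity) ?_
      have habs : |ε * θ| = θ := by rw [abs_mul, hε, one_mul, abs_of_pos h0]
      have := mul_abs_le_norm_circleMap_sub_one hr1.le hr2 (θ := ε * θ) (by rwa [habs])
      rwa [habs] at this
    refine norm_integral_zero_pi_le_of_hasDerivAt
      (K := fun θ => circleMap 0 r (ε * θ) ^ (n + 2) • resolvent a (circleMap 0 r (ε * θ)) ^ 2)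
      (c := ε * Complex.I) (N := n + 1)
      (H := fun θ => circleMap 0 r (ε * θ) ^ (n + 1) • resolvent a (circleMap 0 r (ε * θ)))
      ((hzc.pow _).smul hRc) ((hzc.pow _).smul (hRc.pow 2)) (by simp [hε]) (by linarith)
      (exp_pos 1).le hC (fun θ => ?_) (fun θ => ?_) (fun θ h0 hπ => ?_) (fun θ h0 hπ => ?_)
    · exact_mod_cast hasDerivAt_circleMap_pow_smul_resolvent n (hmem _)
    · rw [norm_smul, norm_pow, hnz]
      calc r ^ (n + 1) * ‖resolvent a (circleMap 0 r (ε * θ))‖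
          ≤ r ^ (n + 1) * (C / (r - 1)) := by
            gcongr; exact hR _ _ (by linarith) (hz1 _)
        _ = r ^ n * C * (1 / (r - 1) * r) := by ring
        _ ≤ exp 1 * C * (n + 1) := by rw [hrN]; gcongr
    · rw [norm_smul, norm_pow, hnz]
      calc r ^ (n + 1) * ‖resolvent a (circleMap 0 r (ε * θ))‖
          ≤ r ^ (n + 1) * (C / (r * (2 / 5 * θ))) := by gcongr; exact hRθ θ h0 hπ
        _ = r ^ n * C * (5 / 2) * (1 / θ) := by field_simp; ring
        _ ≤ exp 1 * C * (5 / 2) * (1 / θ) := by gcongr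
    · rw [norm_smul, norm_pow, hnz]
      calc r ^ (n + 2) * ‖resolvent a (circleMap 0 r (ε * θ)) ^ 2‖
          ≤ r ^ (n + 2) * (C / (r * (2 / 5 * θ))) ^ 2 := by
            gcongr
            exact (norm_pow_le' _ two_pos).trans (by gcongr; exact hRθ θ h0 hπ)
        _ = r ^ n * C ^ 2 * (25 / 4) * θ ^ (-2 : ℤ) := by
            rw [zpow_neg]; norm_cast; field_simp; ring
        _ ≤ exp 1 * C ^ 2 * (25 / 4) * θ ^ (-2 : ℤ) := by gcongr
  have hgc : Continuous fun θ : ℝ => circleMap 0 r θ ^ (n + 1) • resolvent a (circleMap 0 r θ) :=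
    continuous_iff_continuousAt.2 fun θ => by
      simpa using (hasDerivAt_circleMap_pow_smul_resolvent (ε := 1) (θ := θ) n
        (hmem _)).continuousAt
  have hpow := two_pi_smul_pow_eq_integral_resolvent hr0 hsr n
  rw [← intervalIntegral.integral_add_adjacent_intervals (hgc.intervalIntegrable (-π) 0)
    (hgc.intervalIntegrable 0 π)] at hpow
  have hneg := intervalIntegral.integral_comp_neg (a := 0) (b := π)
    (fun θ => circleMap 0 r θ ^ (n + 1) • resolvent a (circleMap 0 r θ))
  rw [neg_zero] at hneg
  have h1 := half 1 (by simp)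
  have h2 := half (-1) (by simp)
  simp only [one_mul, neg_one_mul] at h1 h2
  rw [hneg] at h2
  have hnorm : 2 * π * ‖a ^ n‖ ≤ 2 * (exp 1 * C * (12 + 4 * log C)) := by
    have : ‖(2 * π : ℂ) • a ^ n‖ = 2 * π * ‖a ^ n‖ := by
      rw [norm_smul]; simp [abs_of_pos pi_pos]
    rw [← this, hpow]
    exact (norm_add_le _ _).trans (by linarith)
  rw [div_mul_eq_mul_div, div_mul_eq_mul_div, le_div_iff₀ pi_pos]
  linarith

end resolvent

/-- Power-boundedness of Tadmor–Ritt operators (Corollary 1): for a Tadmor–Ritt operator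
`T` with constant `C ≥ 1`, `s ∈ (0,1)`, `a = 2e/(π(1-s))` and `b = -2 log s + 6`,
`sup_n ‖Tⁿ‖ ≤ a C (2 log C + b)`. -/
theorem tadmorRitt_powerBounded
    {X : Type*} [NormedAddCommGroup X] [NormedSpace ℂ X] [CompleteSpace X]
    (T : X →L[ℂ] X) (C : ℝ) (hC : 1 ≤ C)
    (hspec : spectrum ℂ T ⊆ Metric.closedBall (0 : ℂ) 1)
    (hres : ∀ z : ℂ, 1 < ‖z‖ → ‖(z - 1) • resolvent T z‖ ≤ C)
    (s : ℝ) (hs : s ∈ Set.Ioo (0 : ℝ) 1) :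
    ∀ n : ℕ, ‖T ^ n‖ ≤
      (2 * Real.exp 1 / (π * (1 - s))) * C * (2 * Real.log C + (-2 * Real.log s + 6)) := by
  obtain ⟨hs0, hs1⟩ := hs
  have hlogs : log s ≤ 0 := log_nonpos hs0.le hs1.le
  have hlogC : 0 ≤ log C := log_nonneg hC
  have hle : exp 1 / π * C * (12 + 4 * log C) ≤
      (2 * exp 1 / (π * (1 - s))) * C * (2 * log C + (-2 * log s + 6)) := by
    have h1 : 2 * exp 1 / π ≤ 2 * exp 1 / (π * (1 - s)) := by
      have : 0 < 1 - s := by linarith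
      gcongr
      exact mul_le_of_le_one_right pi_pos.le (by linarith)
    calc exp 1 / π * C * (12 + 4 * log C) = 2 * exp 1 / π * C * (2 * log C + 6) := by ring
      _ ≤ _ := by gcongr; linarith
  intro n
  refine le_trans ?_ hle
  rcases eq_or_ne n 0 with rfl | hn
  · rw [pow_zero]
    refine ContinuousLinearMap.norm_id_le.trans ?_
    rw [div_mul_eq_mul_div, div_mul_eq_mul_div, le_div_iff₀ pi_pos]
    have he : 2 ≤ exp 1 := by linarith [add_one_le_exp (1 : ℝ)]
    calc 1 * π ≤ 2 * 1 * 12 := by linarith [pi_le_four]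
      _ ≤ _ := by gcongr; linarith
  · exact norm_pow_le_of_norm_resolvent_le hC hspec hres hn
end

section
/- Let X be a complex Banach space and T a bounded linear operator on X whose spectrum is contained in the closed unit disc and which satisfies ‖(z−1)(zI−T)⁻¹‖ ≤ C for all |z| > 1. Then for every r ∈ (0,1), the operator rT is again such an operator: its spectrum is contained in the closed unit disc and ‖(λ−1)(λI−rT)⁻¹‖ ≤ 2C/(1+r) for all |λ| > 1. -/
open Real Metric

theorem norm_sub_one_le_mul_norm_sub_of_one_lt_norm {r : ℝ} (hr : r ∈ Set.Ioo (0 : ℝ) 1) {z : ℂ}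
    (hz : 1 < ‖z‖) : (1 + r) * ‖z - 1‖ ≤ 2 * ‖z - r‖ := by
  obtain ⟨h0, h1⟩ := hr
  refine le_of_sq_le_sq ?_ (by positivity)
  have hre : -‖z‖ ≤ z.re := (abs_le.1 (Complex.abs_re_le_norm z)).1
  have hn : ‖z‖ ^ 2 = z.re * z.re + z.im * z.im := by
    rw [Complex.sq_norm, Complex.normSq_apply]
  rw [mul_pow, mul_pow, Complex.sq_norm, Complex.sq_norm, Complex.normSq_apply,
    Complex.normSq_apply]
  simp only [Complex.sub_re, Complex.sub_im, Complex.one_re, Complex.one_im, Complex.ofReal_re,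
    Complex.ofReal_im, sub_zero]
  have key : 0 ≤ (3 + r) * ‖z‖ ^ 2 - (3 * r + 1) + 2 * z.re * (1 - r) := by
    nlinarith [mul_nonneg (by linarith : 0 ≤ z.re + ‖z‖) (by linarith : 0 ≤ 1 - r),
      mul_nonneg (by linarith : 0 ≤ ‖z‖ - 1)
        (by nlinarith : 0 ≤ (3 + r) * ‖z‖ + (1 + 3 * r))]
  rw [hn] at key
  linarith [mul_nonneg (by linarith : 0 ≤ 1 - r) key]

theorem resolvent_smul_eq {𝕜 A : Type*} [Field 𝕜] [Ring A] [Algebra 𝕜 A] {c : 𝕜} (hc : c ≠ 0)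
    (a : A) (s : 𝕜) : resolvent (c • a) s = c⁻¹ • resolvent a (c⁻¹ * s) := by
  have h := spectrum.units_smul_resolvent (r := (Units.mk0 c hc)⁻¹) (s := c⁻¹ * s) (a := a)
  simpa [Units.smul_def, hc] using h.symm

/-- If `T` is a Tadmor–Ritt operator with constant `C`, then for every `r ∈ (0,1)` the
operator `rT` is Tadmor–Ritt with constant `2C/(1+r)`: its spectrum is contained in the
closed unit disc and `‖(λ-1)(λI-rT)⁻¹‖ ≤ 2C/(1+r)` for all `|λ| > 1`. -/
theorem smul_tadmorRitt
    {X : Type*} [NormedAddCommGroup X] [NormedSpace ℂ X] [CompleteSpace X]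
    (T : X →L[ℂ] X) (C : ℝ)
    (hspec : spectrum ℂ T ⊆ Metric.closedBall (0 : ℂ) 1)
    (hres : ∀ z : ℂ, 1 < ‖z‖ → ‖(z - 1) • resolvent T z‖ ≤ C) :
    ∀ r : ℝ, r ∈ Set.Ioo (0 : ℝ) 1 →
      spectrum ℂ ((r : ℂ) • T) ⊆ Metric.closedBall (0 : ℂ) 1 ∧
      ∀ lam : ℂ, 1 < ‖lam‖ →
        ‖(lam - 1) • resolvent ((r : ℂ) • T) lam‖ ≤ 2 * C / (1 + r) := by
  intro r hr
  have h0 : 0 < r := hr.1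
  have hr0 : (r : ℂ) ≠ 0 := by exact_mod_cast h0.ne'
  refine ⟨?_, fun lam hlam => ?_⟩
  · intro x hx
    change x ∈ spectrum ℂ (Units.mk0 (r : ℂ) hr0 • T) at hx
    rw [spectrum.unit_smul_eq_smul] at hx
    obtain ⟨w, hw, rfl⟩ := hx
    have hw1 : ‖w‖ ≤ 1 := by simpa using hspec hw
    simp only [Units.val_mk0, smul_eq_mul, mem_closedBall, dist_zero_right,
      norm_mul, Complex.norm_real, Real.norm_eq_abs, abs_of_pos h0]
    exact mul_le_one₀ hr.2.le (norm_nonneg _) hw1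
  · have hz : 1 < ‖(r : ℂ)⁻¹ * lam‖ := by
      rw [norm_mul, norm_inv, Complex.norm_real, Real.norm_eq_abs, abs_of_pos h0]
      exact one_lt_mul_of_lt_of_le (one_lt_inv_iff₀.2 hr) hlam.le
    have hb := hres _ hz
    have hineq := norm_sub_one_le_mul_norm_sub_of_one_lt_norm hr hlam
    have heq : (lam - r) • resolvent ((r : ℂ) • T) lam
        = ((r : ℂ)⁻¹ * lam - 1) • resolvent T ((r : ℂ)⁻¹ * lam) := by
      rw [resolvent_smul_eq hr0, smul_smul]
      congr 1
      field_simp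
    rw [← heq, norm_smul] at hb
    rw [norm_smul, le_div_iff₀ (by linarith)]
    nlinarith [mul_le_mul_of_nonneg_right hineq
      (norm_nonneg (resolvent ((r : ℂ) • T) lam))]
end

section
/- For every integer m ≥ 0 and every r ∈ (0,1), the series ∑_{k=1}^{∞} k·r^{2(k−1)}/(k+m)² converges and satisfies ∑_{k=1}^{∞} k·r^{2(k−1)}/(k+m)² ≤ 1/(m+1) + log(1 − 1/(2(m+1)·log r)). -/
open Real

lemma inv_one_add_le_log_one_add_inv {z : ℝ} (hz : 0 < z) :
    1 / (1 + z) ≤ log (1 + 1 / z) := by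
  have h := one_sub_inv_le_log_of_pos (x := 1 + 1 / z) (by positivity)
  have e : 1 - (1 + 1 / z)⁻¹ = 1 / (1 + z) := by
    field_simp
    ring
  rwa [e] at h

lemma inv_add_log_le_one_add_mul_log {a c : ℝ} (ha : 0 < a) (hc : 0 < c) :
    1 / (c + 1) + log (1 + 1 / ((c + 1) * a)) ≤ (1 + a) * log (1 + 1 / (c * a)) := by
  have h₁ := inv_one_add_le_log_one_add_inv (mul_pos hc ha)
  have h₂ := inv_one_add_le_log_one_add_inv (z := c * ((c + 1) * a + 1)) (by positivity)
  have h₃ : log (1 + 1 / (c * a)) =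
      log (1 + 1 / ((c + 1) * a)) + log (1 + 1 / (c * ((c + 1) * a + 1))) := by
    rw [← log_mul (by positivity) (by positivity)]
    congr 1
    field_simp
    ring
  have h₄ : 1 / (c + 1) ≤ a * (1 / (1 + c * a)) + 1 / (1 + c * ((c + 1) * a + 1)) := by
    have e : a * (1 / (1 + c * a)) + 1 / (1 + c * ((c + 1) * a + 1)) - 1 / (c + 1) =
        a / ((c + 1) * (1 + c * a)) := by
      have : 1 + c * ((c + 1) * a + 1) = (c + 1) * (1 + c * a) := by ring
      rw [this]
      field_simp
      ring
    have : 0 ≤ a / ((c + 1) * (1 + c * a)) := by positivity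
    linarith
  have h₅ := mul_le_mul_of_nonneg_left h₁ ha.le
  linarith

lemma sum_pow_div_add_le {a q n : ℝ} (ha : 0 < a) (hq : 0 ≤ q) (hqa : q * (1 + a) ≤ 1)
    (hn : 0 < n) (N : ℕ) :
    ∑ j ∈ Finset.range (N + 1), q ^ j / (j + n) ≤
      1 / n + log (1 + 1 / (n * a)) - q ^ N * log (1 + 1 / ((N + n) * a)) := by
  induction N with
  | zero => simp
  | succ N ih =>
    rw [Finset.sum_range_succ]
    have hc : 0 < (N : ℝ) + n := by positivity
    have hL : 0 ≤ log (1 + 1 / ((N + n) * a)) :=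
      (by positivity : (0 : ℝ) ≤ 1 / (1 + (N + n) * a)).trans
        (inv_one_add_le_log_one_add_inv (mul_pos hc ha))
    have h₁ := mul_le_mul_of_nonneg_left (inv_add_log_le_one_add_mul_log ha hc) hq
    have h₂ := mul_le_mul_of_nonneg_right hqa hL
    have h₃ := mul_le_mul_of_nonneg_left
      (h₁.trans (by linarith : _ ≤ log (1 + 1 / ((N + n) * a)))) (pow_nonneg hq N)
    have e : ((N + 1 : ℕ) : ℝ) + n = N + n + 1 := by
      push_cast
      ring
    rw [e, pow_succ, div_eq_mul_one_div]
    linarith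

/-- The series `∑_{k=1}^∞ k r^{2(k-1)} / (k+m)²` (indexed here by `k = j+1`, `j ≥ 0`)
converges and is bounded by `1/(m+1) + log(1 - 1/(2(m+1) log r))` for `0 < r < 1`. -/
theorem series_estimate (m : ℕ) (r : ℝ) (hr : r ∈ Set.Ioo (0 : ℝ) 1) :
    Summable (fun j : ℕ => ((j : ℝ) + 1) * r ^ (2 * j) / (((j : ℝ) + 1) + m) ^ 2) ∧
    ∑' j : ℕ, ((j : ℝ) + 1) * r ^ (2 * j) / (((j : ℝ) + 1) + m) ^ 2
      ≤ 1 / (m + 1) + Real.log (1 - 1 / (2 * (m + 1) * Real.log r)) := by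
  obtain ⟨h0, h1⟩ := hr
  have hlog : log r < 0 := log_neg h0 h1
  obtain ⟨a, ha⟩ : ∃ a, a = -(2 * log r) := ⟨_, rfl⟩
  have ha0 : 0 < a := by linarith
  have hqa : r ^ 2 * (1 + a) ≤ 1 := by
    have h := log_le_sub_one_of_pos (x := (r ^ 2)⁻¹) (by positivity)
    rw [log_inv, log_pow] at h
    push_cast at h
    have h' : 1 + a ≤ (r ^ 2)⁻¹ := by linarith
    calc r ^ 2 * (1 + a) ≤ r ^ 2 * (r ^ 2)⁻¹ := by gcongr
      _ = 1 := mul_inv_cancel₀ (by positivity)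
  have hnonneg : ∀ j : ℕ, 0 ≤ ((j : ℝ) + 1) * r ^ (2 * j) / (((j : ℝ) + 1) + m) ^ 2 :=
    fun j => by positivity
  have hterm : ∀ j : ℕ, ((j : ℝ) + 1) * r ^ (2 * j) / (((j : ℝ) + 1) + m) ^ 2 ≤
      (r ^ 2) ^ j / (j + (m + 1)) := fun j => by
    rw [← pow_mul, div_le_div_iff₀ (by positivity) (by positivity)]
    have hm : (0 : ℝ) ≤ m := m.cast_nonneg
    calc ((j : ℝ) + 1) * r ^ (2 * j) * (j + (m + 1))
        ≤ ((j : ℝ) + 1 + m) * r ^ (2 * j) * (j + (m + 1)) := by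
          gcongr ?_ * _ * _
          linarith
      _ = r ^ (2 * j) * ((j : ℝ) + 1 + m) ^ 2 := by ring
  have harg : 1 - 1 / (2 * ((m : ℝ) + 1) * log r) = 1 + 1 / (((m : ℝ) + 1) * a) := by
    rw [ha, show ((m : ℝ) + 1) * -(2 * log r) = -(2 * ((m : ℝ) + 1) * log r) by ring,
      div_neg, sub_eq_add_neg]
  have hbound : ∀ N : ℕ, ∑ j ∈ Finset.range N,
      ((j : ℝ) + 1) * r ^ (2 * j) / (((j : ℝ) + 1) + m) ^ 2 ≤
      1 / (m + 1) + log (1 - 1 / (2 * (m + 1) * log r)) := fun N => by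
    have h := sum_pow_div_add_le ha0 (sq_nonneg r) hqa (n := (m : ℝ) + 1) (by positivity) N
    have hL : 0 ≤ (r ^ 2) ^ N * log (1 + 1 / ((N + ((m : ℝ) + 1)) * a)) :=
      mul_nonneg (by positivity) (log_nonneg (le_add_of_nonneg_right (by positivity)))
    have hs := Finset.sum_le_sum fun j (_ : j ∈ Finset.range (N + 1)) => hterm j
    rw [Finset.sum_range_succ] at hs
    rw [harg]
    linarith [hnonneg N]
  exact ⟨summable_of_sum_range_le hnonneg hbound,
    Real.tsum_le_of_sum_range_le hnonneg hbound⟩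
end

section
/- Let H be a complex Hilbert space and T a bounded linear operator on H whose spectrum is contained in the closed unit disc and with sup_{|z|>1} ‖(z−1)(zI−T)⁻¹‖ < ∞. Set Pb := sup_{n ∈ ℕ} ‖Tⁿ‖ and c₁ := sup_{n ≥ 1} ‖n(Tⁿ − Tⁿ⁻¹)‖ (both finite), and b := 1 + Pb²/c₁². Then for every integer m ≥ 0, every r ∈ (0,1) and every x ∈ H, ∑_{k=1}^{∞} k·‖r^{k+m} T^{k+m} x − r^{k−1+m} T^{k−1+m} x‖² ≤ 2·c₁²·r^{2m}·(b + log(1 − 1/(2(m+1)·log r)))·‖x‖². -/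
open Real Metric

/-- Discrete analogue of the derivative bound for `t ↦ exp (-s t) log (1 + 1 / (s t))`. -/
lemma pow_div_le_sub_log {q s : ℝ} (hq : 0 < q) (hs : 0 < s) (hqs : q * (1 + s) ≤ 1)
    {N : ℕ} (hN : 0 < N) :
    q ^ (N + 1) / ((N : ℝ) + 1) ≤
      q ^ N * log (1 + 1 / (s * N)) - q ^ (N + 1) * log (1 + 1 / (s * ((N : ℝ) + 1))) := by
  have hN' : (0 : ℝ) < N := by exact_mod_cast hN
  set t : ℝ := (N : ℝ)
  have hlow : 1 / (s * t + 1) ≤ log (1 + 1 / (s * t)) := by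
    have h := one_sub_inv_le_log_of_pos (show 0 < 1 + 1 / (s * t) by positivity)
    refine le_trans (le_of_eq ?_) h
    field_simp
    ring
  have hdiff : 1 / ((s * t + 1) * (t + 1)) ≤
      log (1 + 1 / (s * t)) - log (1 + 1 / (s * (t + 1))) := by
    rw [← log_div (by positivity) (by positivity)]
    have h := one_sub_inv_le_log_of_pos
      (show 0 < (1 + 1 / (s * t)) / (1 + 1 / (s * (t + 1))) by positivity)
    refine le_trans (le_of_eq ?_) h
    field_simp
    ring
  have hsum : 1 / (t + 1) ≤ s * (1 / (s * t + 1)) + 1 / ((s * t + 1) * (t + 1)) := by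
    have : s * (1 / (s * t + 1)) + 1 / ((s * t + 1) * (t + 1)) - 1 / (t + 1)
        = s / ((s * t + 1) * (t + 1)) := by
      field_simp
      ring
    have : 0 ≤ s / ((s * t + 1) * (t + 1)) := by positivity
    linarith
  have hlog : 0 ≤ log (1 + 1 / (s * t)) := le_trans (by positivity) hlow
  have hmain : q * (1 / (t + 1) + log (1 + 1 / (s * (t + 1)))) ≤ log (1 + 1 / (s * t)) := by
    calc q * (1 / (t + 1) + log (1 + 1 / (s * (t + 1))))
        ≤ q * ((1 + s) * log (1 + 1 / (s * t))) := by
          gcongr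
          nlinarith [mul_le_mul_of_nonneg_left hlow hs.le]
      _ = q * (1 + s) * log (1 + 1 / (s * t)) := by ring
      _ ≤ log (1 + 1 / (s * t)) := mul_le_of_le_one_left hlog hqs
  have h := mul_le_mul_of_nonneg_left hmain (pow_pos hq N).le
  have e : q ^ N * (q * (1 / (t + 1) + log (1 + 1 / (s * (t + 1))))) =
      q ^ (N + 1) / (t + 1) + q ^ (N + 1) * log (1 + 1 / (s * (t + 1))) := by ring
  linarith

lemma sum_range_pow_div_le_log {q s : ℝ} (hq : 0 < q) (hs : 0 < s) (hqs : q * (1 + s) ≤ 1)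
    {N : ℕ} (hN : 0 < N) (n : ℕ) :
    ∑ j ∈ Finset.range n, q ^ (j + N + 1) / ((j : ℝ) + N + 1) ≤
      q ^ N * log (1 + 1 / (s * N)) := by
  have htel : ∑ j ∈ Finset.range n, q ^ (j + N + 1) / ((j : ℝ) + N + 1) ≤
      q ^ N * log (1 + 1 / (s * N)) - q ^ (n + N) * log (1 + 1 / (s * ((n : ℝ) + N))) := by
    induction n with
    | zero => simp
    | succ k ih =>
      rw [Finset.sum_range_succ]
      have h := pow_div_le_sub_log hq hs hqs (N := k + N) (by omega)
      push_cast at h ⊢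
      rw [show k + 1 + N = k + N + 1 by ring, show (k : ℝ) + 1 + N = k + N + 1 by ring]
      linarith
  have hlast : 0 ≤ q ^ (n + N) * log (1 + 1 / (s * ((n : ℝ) + N))) := by
    have : 0 ≤ 1 / (s * ((n : ℝ) + N)) := by positivity
    exact mul_nonneg (by positivity) (log_nonneg (by linarith))
  linarith

lemma sum_range_pow_div_le {q s : ℝ} (hq : 0 < q) (hs : 0 < s) (hqs : q * (1 + s) ≤ 1)
    (m n : ℕ) :
    ∑ j ∈ Finset.range n, q ^ (j + m + 1) / ((j : ℝ) + m + 1) ≤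
      q ^ m * (1 + log (1 + 1 / (s * (m + 1)))) := by
  have hq1 : q ≤ 1 := by nlinarith
  have hlog : 0 ≤ log (1 + 1 / (s * ((m : ℝ) + 1))) := by
    have : 0 ≤ 1 / (s * ((m : ℝ) + 1)) := by positivity
    exact log_nonneg (by linarith)
  have hpow : q ^ (m + 1) ≤ q ^ m := pow_le_pow_of_le_one hq.le hq1 (Nat.le_succ m)
  cases n with
  | zero =>
    simp only [Finset.range_zero, Finset.sum_empty]
    positivity
  | succ k =>
    rw [Finset.sum_range_succ']
    have h := sum_range_pow_div_le_log hq hs hqs (N := m + 1) (by omega) k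
    have hfirst : q ^ (m + 1) / ((m : ℝ) + 1) ≤ q ^ m :=
      (div_le_self (by positivity) (by linarith [m.cast_nonneg (α := ℝ)])).trans hpow
    have hrest := mul_le_mul_of_nonneg_right hpow hlog
    have e : ∑ j ∈ Finset.range k, q ^ (j + 1 + m + 1) / (((j + 1 : ℕ) : ℝ) + m + 1) =
        ∑ j ∈ Finset.range k, q ^ (j + (m + 1) + 1) / ((j : ℝ) + (m + 1 : ℕ) + 1) := by
      refine Finset.sum_congr rfl fun j _ => ?_
      rw [show j + 1 + m + 1 = j + (m + 1) + 1 by ring]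
      push_cast
      ring
    rw [e]
    push_cast at h ⊢
    simp only [zero_add]
    linarith

lemma sq_mul_sum_range_succ_mul_pow_le_one {q : ℝ} (hq : 0 ≤ q) (hq1 : q ≤ 1) (n : ℕ) :
    (1 - q) ^ 2 * ∑ j ∈ Finset.range n, ((j : ℝ) + 1) * q ^ j ≤ 1 := by
  have h : (1 - q) ^ 2 * ∑ j ∈ Finset.range n, ((j : ℝ) + 1) * q ^ j =
      1 - q ^ n - n * (q ^ n * (1 - q)) := by
    induction n with
    | zero => simp
    | succ k ih =>
      rw [Finset.sum_range_succ, mul_add, ih]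
      push_cast
      ring
  have : 0 ≤ n * (q ^ n * (1 - q)) := by
    have : 0 ≤ 1 - q := by linarith
    positivity
  linarith [pow_nonneg hq n]

lemma norm_smul_pow_succ_sub_sq_le {H : Type*} [NormedAddCommGroup H] [NormedSpace ℂ H]
    (T : H →L[ℂ] H) {Pb c₁ : ℝ} (hPb : ∀ n : ℕ, ‖T ^ n‖ ≤ Pb)
    (hc₁ : ∀ n : ℕ, 1 ≤ n → ‖(n : ℝ) • (T ^ n - T ^ (n - 1))‖ ≤ c₁)
    {r : ℝ} (hr0 : 0 ≤ r) (hr1 : r ≤ 1) (n : ℕ) (x : H) :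
    ‖r ^ (n + 1) • (T ^ (n + 1)) x - r ^ n • (T ^ n) x‖ ^ 2 ≤
      2 * (c₁ ^ 2 * ((r ^ 2) ^ (n + 1) / ((n : ℝ) + 1) ^ 2) +
        Pb ^ 2 * ((1 - r) ^ 2 * (r ^ 2) ^ n)) * ‖x‖ ^ 2 := by
  have hsplit : r ^ (n + 1) • (T ^ (n + 1)) x - r ^ n • (T ^ n) x =
      r ^ (n + 1) • (T ^ (n + 1) - T ^ n) x - (r ^ n * (1 - r)) • (T ^ n) x := by
    rw [sub_apply]
    module
  have hdiff : ‖T ^ (n + 1) - T ^ n‖ ≤ c₁ / ((n : ℝ) + 1) := by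
    have h := hc₁ (n + 1) (by omega)
    rw [norm_smul, Real.norm_of_nonneg (by positivity), Nat.add_sub_cancel] at h
    rw [le_div_iff₀' (by positivity)]
    exact_mod_cast h
  have h1r : 0 ≤ 1 - r := by linarith
  have h1 : ‖r ^ (n + 1) • (T ^ (n + 1) - T ^ n) x‖ ≤
      r ^ (n + 1) * (c₁ / ((n : ℝ) + 1) * ‖x‖) := by
    rw [norm_smul, Real.norm_of_nonneg (by positivity)]
    gcongr
    exact ContinuousLinearMap.le_of_opNorm_le _ hdiff x
  have h2 : ‖(r ^ n * (1 - r)) • (T ^ n) x‖ ≤ r ^ n * (1 - r) * (Pb * ‖x‖) := by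
    rw [norm_smul, Real.norm_of_nonneg (by positivity)]
    gcongr
    exact ContinuousLinearMap.le_of_opNorm_le _ (hPb n) x
  rw [hsplit]
  calc _ ≤ (r ^ (n + 1) * (c₁ / ((n : ℝ) + 1) * ‖x‖) + r ^ n * (1 - r) * (Pb * ‖x‖)) ^ 2 := by
        gcongr
        exact (norm_sub_le _ _).trans (add_le_add h1 h2)
    _ ≤ 2 * ((r ^ (n + 1) * (c₁ / ((n : ℝ) + 1) * ‖x‖)) ^ 2 +
          (r ^ n * (1 - r) * (Pb * ‖x‖)) ^ 2) := add_sq_le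
    _ = _ := by
        simp only [mul_pow, div_pow, ← pow_mul]
        ring

/-- Discrete square function estimate for `(rT)^m` (Lemma on square function estimates):
for a Tadmor–Ritt operator `T` on a Hilbert space with power-bound `Pb`, difference bound
`c₁ = sup_{n≥1} ‖n(Tⁿ - Tⁿ⁻¹)‖ > 0` and `b = 1 + Pb²/c₁²`, one has for every `m ≥ 0`,
`r ∈ (0,1)` and `x`,
`∑_{k≥1} k ‖r^{k+m} T^{k+m} x - r^{k-1+m} T^{k-1+m} x‖² ≤ 2 c₁² r^{2m} (b + log(1 - 1/(2(m+1) log r))) ‖x‖²`. -/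
theorem square_function_estimate_smul_pow
    {H : Type*} [NormedAddCommGroup H] [InnerProductSpace ℂ H] [CompleteSpace H]
    (T : H →L[ℂ] H)
    (hspec : spectrum ℂ T ⊆ Metric.closedBall (0 : ℂ) 1)
    (hres : ∃ C : ℝ, ∀ z : ℂ, 1 < ‖z‖ → ‖(z - 1) • resolvent T z‖ ≤ C)
    (Pb c₁ : ℝ) (hc₁pos : 0 < c₁)
    (hPb : ∀ n : ℕ, ‖T ^ n‖ ≤ Pb)
    (hc₁ : ∀ n : ℕ, 1 ≤ n → ‖(n : ℝ) • (T ^ n - T ^ (n - 1))‖ ≤ c₁)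
    (m : ℕ) (r : ℝ) (hr : r ∈ Set.Ioo (0 : ℝ) 1) (x : H) :
    Summable (fun j : ℕ => ((j : ℝ) + 1) *
        ‖r ^ (j + 1 + m) • (T ^ (j + 1 + m)) x - r ^ (j + m) • (T ^ (j + m)) x‖ ^ 2) ∧
    ∑' j : ℕ, ((j : ℝ) + 1) *
        ‖r ^ (j + 1 + m) • (T ^ (j + 1 + m)) x - r ^ (j + m) • (T ^ (j + m)) x‖ ^ 2
      ≤ 2 * c₁ ^ 2 * r ^ (2 * m) *
          ((1 + Pb ^ 2 / c₁ ^ 2) + Real.log (1 - 1 / (2 * (m + 1) * Real.log r))) *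
          ‖x‖ ^ 2 := by
  obtain ⟨hr0, hr1⟩ := hr
  have hlogr : log r < 0 := log_neg hr0 hr1
  have hq : 0 < r ^ 2 := by positivity
  have hq1 : r ^ 2 ≤ 1 := pow_le_one₀ hr0.le hr1.le
  have hqs : r ^ 2 * (1 + -2 * log r) ≤ 1 := by
    have h := log_le_sub_one_of_pos (inv_pos.mpr hq)
    rw [log_inv, log_pow] at h
    push_cast at h
    calc r ^ 2 * (1 + -2 * log r) ≤ r ^ 2 * (r ^ 2)⁻¹ := by
          gcongr
          linarith
      _ = 1 := mul_inv_cancel₀ hq.ne'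
  have hterm (j : ℕ) : ((j : ℝ) + 1) *
      ‖r ^ (j + 1 + m) • (T ^ (j + 1 + m)) x - r ^ (j + m) • (T ^ (j + m)) x‖ ^ 2 ≤
      2 * c₁ ^ 2 * ‖x‖ ^ 2 * ((r ^ 2) ^ (j + m + 1) / ((j : ℝ) + m + 1)) +
      2 * Pb ^ 2 * r ^ (2 * m) * ‖x‖ ^ 2 *
        ((1 - r ^ 2) ^ 2 * (((j : ℝ) + 1) * (r ^ 2) ^ j)) := by
    have h := norm_smul_pow_succ_sub_sq_le T hPb hc₁ hr0.le hr1.le (j + m) x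
    rw [show j + 1 + m = j + m + 1 by ring]
    rw [Nat.cast_add] at h
    have hfrac : ((j : ℝ) + 1) / ((j : ℝ) + m + 1) ^ 2 ≤ 1 / ((j : ℝ) + m + 1) := by
      rw [div_le_div_iff₀ (by positivity) (by positivity)]
      nlinarith [j.cast_nonneg (α := ℝ), m.cast_nonneg (α := ℝ)]
    have hsq : (1 - r) ^ 2 ≤ (1 - r ^ 2) ^ 2 := by
      apply pow_le_pow_left₀ (by linarith)
      nlinarith
    calc _ ≤ ((j : ℝ) + 1) * _ := mul_le_mul_of_nonneg_left h (by positivity)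
      _ = 2 * c₁ ^ 2 * ‖x‖ ^ 2 *
            ((r ^ 2) ^ (j + m + 1) * (((j : ℝ) + 1) / ((j : ℝ) + m + 1) ^ 2)) +
          2 * Pb ^ 2 * r ^ (2 * m) * ‖x‖ ^ 2 *
            ((1 - r) ^ 2 * (((j : ℝ) + 1) * (r ^ 2) ^ j)) := by
          rw [pow_mul, pow_add (r ^ 2) j m]
          ring
      _ ≤ 2 * c₁ ^ 2 * ‖x‖ ^ 2 * ((r ^ 2) ^ (j + m + 1) * (1 / ((j : ℝ) + m + 1))) +
          2 * Pb ^ 2 * r ^ (2 * m) * ‖x‖ ^ 2 *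
            ((1 - r ^ 2) ^ 2 * (((j : ℝ) + 1) * (r ^ 2) ^ j)) := by
          gcongr
      _ = _ := by rw [mul_one_div]
  have hpartial (n : ℕ) : ∑ j ∈ Finset.range n, ((j : ℝ) + 1) *
      ‖r ^ (j + 1 + m) • (T ^ (j + 1 + m)) x - r ^ (j + m) • (T ^ (j + m)) x‖ ^ 2 ≤
      2 * c₁ ^ 2 * r ^ (2 * m) *
          ((1 + Pb ^ 2 / c₁ ^ 2) + Real.log (1 - 1 / (2 * (m + 1) * Real.log r))) *
          ‖x‖ ^ 2 := by
    have hA := sum_range_pow_div_le hq (by linarith) hqs m n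
    have hB := sq_mul_sum_range_succ_mul_pow_le_one hq.le hq1 n
    have hlogarg : 1 + 1 / (-2 * log r * ((m : ℝ) + 1)) =
        1 - 1 / (2 * ((m : ℝ) + 1) * log r) := by
      rw [show -2 * log r * ((m : ℝ) + 1) = -(2 * ((m : ℝ) + 1) * log r) by ring,
        one_div_neg_eq_neg_one_div]
      ring
    rw [hlogarg] at hA
    refine (Finset.sum_le_sum fun j _ => hterm j).trans ?_
    rw [Finset.sum_add_distrib, ← Finset.mul_sum, ← Finset.mul_sum, ← Finset.mul_sum]
    refine (add_le_add (mul_le_mul_of_nonneg_left hA (by positivity))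
      (mul_le_mul_of_nonneg_left hB (by rw [pow_mul]; positivity))).trans (le_of_eq ?_)
    rw [pow_mul]
    field_simp
    ring
  have hnonneg (j : ℕ) : 0 ≤ ((j : ℝ) + 1) *
      ‖r ^ (j + 1 + m) • (T ^ (j + 1 + m)) x - r ^ (j + m) • (T ^ (j + m)) x‖ ^ 2 := by
    positivity
  exact ⟨summable_of_sum_range_le hnonneg hpartial, Real.tsum_le_of_sum_range_le hnonneg hpartial⟩
end

section
/- Let H be a complex Hilbert space and T a bounded linear operator on H whose spectrum is contained in the closed unit disc and with sup_{|z|>1} ‖(z−1)(zI−T)⁻¹‖ < ∞. Then the following are equivalent: (i) there exists K > 0 such that ∑_{k=1}^{∞} k·‖T^k x − T^{k−1} x‖² ≤ K²·‖x‖² for all x ∈ H; (ii) there exists K > 0 such that for all r ∈ (0,1) and all x ∈ H, ∑_{k=1}^{∞} k·‖(rT)^k x − (rT)^{k−1} x‖² ≤ K²·‖x‖². -/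
open Real Metric

/-- Parseval's identity for the discrete Fourier transform of vectors in a Hilbert space. -/
lemma sum_norm_sq_dft {H : Type*} [NormedAddCommGroup H] [InnerProductSpace ℂ H]
    {N : ℕ} {ζ : ℂ} (hζ : IsPrimitiveRoot ζ N) (hN : N ≠ 0) (a : ℕ → H) :
    ∑ k ∈ Finset.range N, ‖∑ j ∈ Finset.range N, (ζ ^ k) ^ j • a j‖ ^ 2
      = N * ∑ j ∈ Finset.range N, ‖a j‖ ^ 2 := by
  have hnorm : ‖ζ‖ = 1 := hζ.norm'_eq_one hN
  have hζ0 : ζ ≠ 0 := hζ.ne_zero hN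
  have hconj : (starRingEnd ℂ) ζ = ζ⁻¹ := (Complex.inv_eq_conj hnorm).symm
  have key : ∀ j ∈ Finset.range N, ∀ l ∈ Finset.range N,
      ∑ k ∈ Finset.range N, (ζ⁻¹ ^ k) ^ j * (ζ ^ k) ^ l = if j = l then (N : ℂ) else 0 := by
    intro j hj l hl
    have h1 : ∀ k, (ζ⁻¹ ^ k) ^ j * (ζ ^ k) ^ l = (ζ⁻¹ ^ j * ζ ^ l) ^ k := by
      intro k
      rw [mul_pow, ← pow_mul, ← pow_mul, ← pow_mul, ← pow_mul, mul_comm k j, mul_comm k l]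
    simp only [h1]
    split_ifs with h
    · subst h
      have : ζ⁻¹ ^ j * ζ ^ j = 1 := by rw [← mul_pow, inv_mul_cancel₀ hζ0, one_pow]
      simp only [this, one_pow, Finset.sum_const, Finset.card_range, nsmul_eq_mul, mul_one]
    · have hne : ζ⁻¹ ^ j * ζ ^ l ≠ 1 := by
        intro h2
        apply h
        apply hζ.pow_inj (Finset.mem_range.1 hj) (Finset.mem_range.1 hl)
        rw [inv_pow] at h2
        exact (inv_mul_eq_one₀ (pow_ne_zero _ hζ0)).1 h2
      have h3 : (ζ⁻¹ ^ j * ζ ^ l) ^ N = 1 := by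
        rw [mul_pow, ← pow_mul, ← pow_mul, mul_comm j, mul_comm l, pow_mul, pow_mul, inv_pow,
          hζ.pow_eq_one]
        simp
      rw [geom_sum_eq hne, h3]
      simp
  have hC : (∑ k ∈ Finset.range N,
      (inner ℂ (∑ j ∈ Finset.range N, (ζ ^ k) ^ j • a j)
        (∑ j ∈ Finset.range N, (ζ ^ k) ^ j • a j) : ℂ))
      = N * ∑ j ∈ Finset.range N, (inner ℂ (a j) (a j) : ℂ) := by
    simp only [sum_inner, inner_sum, inner_smul_left, inner_smul_right, map_pow, hconj,
      Finset.mul_sum]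
    rw [Finset.sum_comm]
    refine Finset.sum_congr rfl fun j hj => ?_
    rw [Finset.sum_comm]
    have hcol : ∀ l ∈ Finset.range N, ∑ k ∈ Finset.range N,
        (ζ ^ k) ^ j * ((ζ⁻¹ ^ k) ^ l * (inner ℂ (a l) (a j) : ℂ))
        = if j = l then (N : ℂ) * inner ℂ (a l) (a j) else 0 := by
      intro l hl
      simp only [← mul_assoc]
      simp only [mul_comm ((ζ ^ _) ^ _)]
      rw [← Finset.sum_mul, key l hl j hj]
      simp only [eq_comm (a := l)]
      split_ifs <;> simp
    calc _ = _ := Finset.sum_congr rfl hcol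
      _ = _ := by rw [Finset.sum_ite_eq, if_pos hj]
  have hself : ∀ y : H, (inner ℂ y y : ℂ) = ((‖y‖ ^ 2 : ℝ) : ℂ) := by
    intro y
    rw [inner_self_eq_norm_sq_to_K]
    push_cast
    rfl
  simp only [hself] at hC
  exact_mod_cast hC

section

variable {H : Type*} [NormedAddCommGroup H] [InnerProductSpace ℂ H]

/-- Under the Tadmor–Ritt resolvent bound, partial sums of the Neumann series at `w` with `‖w‖ < 1`
are dominated by the corresponding scalar geometric sums. -/
lemma norm_geom_sum_apply_le {T : H →L[ℂ] H}
    (hspec : spectrum ℂ T ⊆ Metric.closedBall (0 : ℂ) 1) {C : ℝ}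
    (hC : ∀ z : ℂ, 1 < ‖z‖ → ‖(z - 1) • resolvent T z‖ ≤ C)
    {w : ℂ} (hw0 : w ≠ 0) (hw : ‖w‖ < 1) (N : ℕ) (x : H) :
    ‖1 - w ^ N‖ * ‖∑ j ∈ Finset.range N, w ^ j • (T ^ j) x‖
      ≤ C * ‖x - w ^ N • (T ^ N) x‖ * ‖∑ j ∈ Finset.range N, w ^ j‖ := by
  have hz : 1 < ‖w⁻¹‖ := by
    rw [norm_inv]; exact (one_lt_inv₀ (norm_pos_iff.2 hw0)).2 hw
  have hu : IsUnit (algebraMap ℂ (H →L[ℂ] H) w⁻¹ - T) := by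
    by_contra h
    have := hspec (show w⁻¹ ∈ spectrum ℂ T from h)
    rw [mem_closedBall_zero_iff] at this
    linarith
  have hinv : resolvent T w⁻¹ * (algebraMap ℂ (H →L[ℂ] H) w⁻¹ - T) = 1 :=
    Ring.inverse_mul_cancel _ hu
  have halg : (algebraMap ℂ (H →L[ℂ] H) w⁻¹ - T) * ∑ j ∈ Finset.range N, (w • T) ^ j
      = w⁻¹ • (1 - (w • T) ^ N) := by
    rw [← mul_neg_geom_sum, ← smul_mul_assoc, smul_sub, smul_smul, inv_mul_cancel₀ hw0, one_smul,
      Algebra.algebraMap_eq_smul_one]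
  have hS : ∑ j ∈ Finset.range N, (w • T) ^ j = w⁻¹ • (resolvent T w⁻¹ * (1 - (w • T) ^ N)) := by
    rw [← mul_smul_comm, ← halg, ← mul_assoc, hinv, one_mul]
  have hSx : ∑ j ∈ Finset.range N, w ^ j • (T ^ j) x
      = w⁻¹ • resolvent T w⁻¹ (x - w ^ N • (T ^ N) x) := by
    have := congrArg (fun A : H →L[ℂ] H => A x) hS
    simpa [smul_pow, sum_apply] using this
  have hg : 1 - w ^ N = (1 - w) * ∑ j ∈ Finset.range N, w ^ j := (mul_neg_geom_sum w N).symm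
  have hfac : (1 - w) • (w⁻¹ • resolvent T w⁻¹ (x - w ^ N • (T ^ N) x))
      = ((w⁻¹ - 1) • resolvent T w⁻¹) (x - w ^ N • (T ^ N) x) := by
    rw [smul_smul, smul_apply]
    congr 1
    field_simp
  have hbound : ‖1 - w‖ * ‖∑ j ∈ Finset.range N, w ^ j • (T ^ j) x‖
      ≤ C * ‖x - w ^ N • (T ^ N) x‖ := by
    rw [hSx, ← norm_smul, hfac]
    exact ContinuousLinearMap.le_of_opNorm_le _ (hC _ hz) _
  rw [hg, norm_mul, mul_right_comm]
  gcongr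

/-- A Tadmor–Ritt operator with subexponentially growing orbits has quadratic Abel means of its
orbits bounded as if it were power bounded. -/
lemma sum_pow_mul_norm_sq_le {T : H →L[ℂ] H}
    (hspec : spectrum ℂ T ⊆ Metric.closedBall (0 : ℂ) 1) {C : ℝ}
    (hC : ∀ z : ℂ, 1 < ‖z‖ → ‖(z - 1) • resolvent T z‖ ≤ C)
    {r : ℝ} (hr0 : 0 < r) (hr1 : r < 1) (x : H)
    (hlim : Filter.Tendsto (fun N : ℕ => (r : ℂ) ^ N • (T ^ N) x) Filter.atTop (nhds 0)) (M : ℕ) :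
    ∑ j ∈ Finset.range M, (r ^ 2) ^ j * ‖(T ^ j) x‖ ^ 2 ≤ C ^ 2 * ‖x‖ ^ 2 * (1 - r ^ 2)⁻¹ := by
  have hN : ∀ N : ℕ, N ≠ 0 →
      (1 - r ^ N) ^ 2 * ∑ j ∈ Finset.range N, (r ^ 2) ^ j * ‖(T ^ j) x‖ ^ 2
        ≤ C ^ 2 * ‖x - (r : ℂ) ^ N • (T ^ N) x‖ ^ 2 * ∑ j ∈ Finset.range N, (r ^ 2) ^ j := by
    intro N hN
    have hζ := Complex.isPrimitiveRoot_exp N hN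
    set ζ := Complex.exp (2 * π * Complex.I / N)
    have hnorm : ‖ζ‖ = 1 := hζ.norm'_eq_one hN
    have hr : (r : ℂ) ≠ 0 := by exact_mod_cast hr0.ne'
    have h1 := sum_norm_sq_dft hζ hN (fun j => (r : ℂ) ^ j • (T ^ j) x)
    have h2 := sum_norm_sq_dft hζ hN (fun j => (r : ℂ) ^ j)
    have hk : ∀ k, (1 - r ^ N) ^ 2
          * ‖∑ j ∈ Finset.range N, (ζ ^ k) ^ j • ((r : ℂ) ^ j • (T ^ j) x)‖ ^ 2
        ≤ C ^ 2 * ‖x - (r : ℂ) ^ N • (T ^ N) x‖ ^ 2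
          * ‖∑ j ∈ Finset.range N, (ζ ^ k) ^ j • (r : ℂ) ^ j‖ ^ 2 := by
      intro k
      have h := norm_geom_sum_apply_le hspec hC (w := ζ ^ k * r)
        (mul_ne_zero (pow_ne_zero _ (hζ.ne_zero hN)) hr) (by simp [hnorm, abs_of_pos hr0, hr1]) N x
      have hpow : (ζ ^ k * (r : ℂ)) ^ N = (r : ℂ) ^ N := by
        rw [mul_pow, ← pow_mul, mul_comm k, pow_mul, hζ.pow_eq_one, one_pow, one_mul]
      have hre : ‖(1 : ℂ) - (r : ℂ) ^ N‖ ^ 2 = (1 - r ^ N) ^ 2 := by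
        rw [show (1 : ℂ) - (r : ℂ) ^ N = ((1 - r ^ N : ℝ) : ℂ) by push_cast; rfl, Complex.norm_real,
          Real.norm_eq_abs, sq_abs]
      rw [hpow] at h
      simp only [mul_pow] at h
      simp only [smul_smul, smul_eq_mul]
      rw [← hre, ← mul_pow, ← mul_pow, ← mul_pow]
      exact pow_le_pow_left₀ (by positivity) h 2
    have hsum := Finset.sum_le_sum (s := Finset.range N) fun k _ => hk k
    rw [← Finset.mul_sum, ← Finset.mul_sum, h1, h2] at hsum
    have hn : ∀ j, ‖(r : ℂ) ^ j‖ ^ 2 = (r ^ 2) ^ j := by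
      intro j
      rw [norm_pow, Complex.norm_real, Real.norm_eq_abs, abs_of_pos hr0, ← pow_mul, ← pow_mul,
        mul_comm]
    simp only [norm_smul, mul_pow, hn] at hsum
    have hNpos : (0 : ℝ) < N := by exact_mod_cast Nat.pos_of_ne_zero hN
    refine le_of_mul_le_mul_left ?_ hNpos
    linarith
  have hr2 : r ^ 2 < 1 := by nlinarith
  have hl : Filter.Tendsto (fun N : ℕ => (1 - r ^ N) ^ 2
      * ∑ j ∈ Finset.range M, (r ^ 2) ^ j * ‖(T ^ j) x‖ ^ 2) Filter.atTop
      (nhds ((1 - 0) ^ 2 * ∑ j ∈ Finset.range M, (r ^ 2) ^ j * ‖(T ^ j) x‖ ^ 2)) :=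
    ((tendsto_const_nhds.sub (tendsto_pow_atTop_nhds_zero_of_lt_one hr0.le hr1)).pow 2).mul_const _
  have hR : Filter.Tendsto (fun N : ℕ => C ^ 2 * ‖x - (r : ℂ) ^ N • (T ^ N) x‖ ^ 2
      * (1 - r ^ 2)⁻¹) Filter.atTop (nhds (C ^ 2 * ‖x - 0‖ ^ 2 * (1 - r ^ 2)⁻¹)) :=
    (((tendsto_const_nhds.sub hlim).norm.pow 2).const_mul _).mul_const _
  rw [sub_zero, one_pow, one_mul] at hl
  rw [sub_zero] at hR
  refine le_of_tendsto_of_tendsto hl hR ?_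
  filter_upwards [Filter.eventually_ge_atTop (M + 1)] with N hMN
  calc _ ≤ (1 - r ^ N) ^ 2 * ∑ j ∈ Finset.range N, (r ^ 2) ^ j * ‖(T ^ j) x‖ ^ 2 := by
        gcongr
        omega
    _ ≤ _ := hN N (by omega)
    _ ≤ _ := by
        gcongr
        rw [← tsum_geometric_of_lt_one (by positivity) hr2]
        exact (summable_geometric_of_lt_one (by positivity) hr2).sum_le_tsum _
          fun i _ => by positivity

lemma add_one_mul_pow_le_inv_one_sub {r : ℝ} (hr0 : 0 ≤ r) (hr1 : r < 1) (j : ℕ) :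
    ((j : ℝ) + 1) * r ^ j ≤ (1 - r)⁻¹ := by
  calc ((j : ℝ) + 1) * r ^ j = ∑ i ∈ Finset.range (j + 1), r ^ j := by simp
    _ ≤ ∑ i ∈ Finset.range (j + 1), r ^ i := Finset.sum_le_sum fun i hi =>
        pow_le_pow_of_le_one hr0 hr1.le (Nat.lt_succ_iff.1 (Finset.mem_range.1 hi))
    _ ≤ ∑' i, r ^ i := (summable_geometric_of_lt_one hr0 hr1).sum_le_tsum _
        fun i _ => by positivity
    _ = _ := tsum_geometric_of_lt_one hr0 hr1

/-- Square function estimates force at most linear growth of orbits. -/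
lemma norm_pow_apply_le_of_norm_sub_le {T : H →L[ℂ] H} {x : H} {B : ℝ}
    (h : ∀ j : ℕ, ‖(T ^ (j + 1)) x - (T ^ j) x‖ ≤ B) (n : ℕ) :
    ‖(T ^ n) x‖ ≤ ‖x‖ + n * B := by
  induction n with
  | zero => simp
  | succ n ih =>
    have := norm_le_norm_add_norm_sub' ((T ^ (n + 1)) x) ((T ^ n) x)
    have := h n
    rw [Nat.cast_succ]
    linarith

lemma tendsto_smul_pow_apply_of_norm_sub_le {T : H →L[ℂ] H} {x : H} {B : ℝ}
    (h : ∀ j : ℕ, ‖(T ^ (j + 1)) x - (T ^ j) x‖ ≤ B) {r : ℝ} (hr0 : 0 ≤ r) (hr1 : r < 1) :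
    Filter.Tendsto (fun N : ℕ => (r : ℂ) ^ N • (T ^ N) x) Filter.atTop (nhds 0) := by
  have hlim : Filter.Tendsto (fun N : ℕ => r ^ N * ‖x‖ + (N * r ^ N) * B) Filter.atTop
      (nhds (0 * ‖x‖ + 0 * B)) :=
    ((tendsto_pow_atTop_nhds_zero_of_lt_one hr0 hr1).mul_const _).add
      ((tendsto_self_mul_const_pow_of_lt_one hr0 hr1).mul_const _)
  rw [zero_mul, zero_mul, add_zero] at hlim
  refine squeeze_zero_norm (fun N => ?_) hlim
  rw [norm_smul, norm_pow, Complex.norm_real, Real.norm_eq_abs, abs_of_nonneg hr0]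
  have := mul_le_mul_of_nonneg_left (norm_pow_apply_le_of_norm_sub_le h N) (pow_nonneg hr0 N)
  linarith

/-- Quantitative form of the passage from square function estimates for `T` to those of `r T`. -/
lemma sum_square_function_smul_le {T : H →L[ℂ] H}
    (hspec : spectrum ℂ T ⊆ Metric.closedBall (0 : ℂ) 1) {C : ℝ}
    (hC : ∀ z : ℂ, 1 < ‖z‖ → ‖(z - 1) • resolvent T z‖ ≤ C) {x : H} {A : ℝ}
    (hA : ∀ M : ℕ,
      ∑ j ∈ Finset.range M, ((j : ℝ) + 1) * ‖(T ^ (j + 1)) x - (T ^ j) x‖ ^ 2 ≤ A)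
    {r : ℝ} (hr : r ∈ Set.Ioo (0 : ℝ) 1) (M : ℕ) :
    ∑ j ∈ Finset.range M,
        ((j : ℝ) + 1) * ‖r ^ (j + 1) • (T ^ (j + 1)) x - r ^ j • (T ^ j) x‖ ^ 2
      ≤ 2 * A + 2 * (C ^ 2 * ‖x‖ ^ 2) := by
  obtain ⟨hr0, hr1⟩ := hr
  have hstep : ∀ j : ℕ, ‖(T ^ (j + 1)) x - (T ^ j) x‖ ≤ √A := by
    intro j
    refine Real.le_sqrt_of_sq_le ?_
    have h1 := Finset.single_le_sum
      (f := fun j : ℕ => ((j : ℝ) + 1) * ‖(T ^ (j + 1)) x - (T ^ j) x‖ ^ 2)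
      (fun i _ => by positivity) (Finset.self_mem_range_succ j)
    have h2 : ‖(T ^ (j + 1)) x - (T ^ j) x‖ ^ 2
        ≤ ((j : ℝ) + 1) * ‖(T ^ (j + 1)) x - (T ^ j) x‖ ^ 2 :=
      le_mul_of_one_le_left (by positivity) (by linarith [(Nat.cast_nonneg j : (0 : ℝ) ≤ j)])
    exact h2.trans (h1.trans (hA _))
  have hs1 : √r < 1 := by rw [Real.sqrt_lt' one_pos]; simpa using hr1
  have habel := sum_pow_mul_norm_sq_le hspec hC (Real.sqrt_pos.2 hr0) hs1 x
    (tendsto_smul_pow_apply_of_norm_sub_le hstep (Real.sqrt_nonneg r) hs1) M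
  rw [Real.sq_sqrt hr0.le] at habel
  have h1r : 0 < 1 - r := by linarith
  have hterm : ∀ j : ℕ,
      ((j : ℝ) + 1) * ‖r ^ (j + 1) • (T ^ (j + 1)) x - r ^ j • (T ^ j) x‖ ^ 2
        ≤ 2 * (((j : ℝ) + 1) * ‖(T ^ (j + 1)) x - (T ^ j) x‖ ^ 2)
          + 2 * (1 - r) * (r ^ j * ‖(T ^ j) x‖ ^ 2) := by
    intro j
    have hdec : r ^ (j + 1) • (T ^ (j + 1)) x - r ^ j • (T ^ j) x
        = r ^ (j + 1) • ((T ^ (j + 1)) x - (T ^ j) x) - ((1 - r) * r ^ j) • (T ^ j) x := by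
      module
    have hle : ‖r ^ (j + 1) • (T ^ (j + 1)) x - r ^ j • (T ^ j) x‖
        ≤ ‖(T ^ (j + 1)) x - (T ^ j) x‖ + (1 - r) * r ^ j * ‖(T ^ j) x‖ := by
      rw [hdec]
      refine (norm_sub_le _ _).trans ?_
      rw [norm_smul, norm_smul, Real.norm_of_nonneg (by positivity : 0 ≤ r ^ (j + 1)),
        Real.norm_of_nonneg (by positivity : 0 ≤ (1 - r) * r ^ j)]
      gcongr
      exact mul_le_of_le_one_left (norm_nonneg _) (pow_le_one₀ hr0.le hr1.le)
    have hsq := (pow_le_pow_left₀ (norm_nonneg _) hle 2).trans add_sq_le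
    have hw : (1 - r) * (((j : ℝ) + 1) * r ^ j) ≤ 1 := by
      have := mul_le_mul_of_nonneg_left (add_one_mul_pow_le_inv_one_sub hr0.le hr1 j) h1r.le
      rwa [mul_inv_cancel₀ h1r.ne'] at this
    have hw2 := mul_le_mul_of_nonneg_right hw
      (by positivity : 0 ≤ 2 * (1 - r) * (r ^ j * ‖(T ^ j) x‖ ^ 2))
    have hj := mul_le_mul_of_nonneg_left hsq (by positivity : (0 : ℝ) ≤ (j : ℝ) + 1)
    linarith
  calc _ ≤ ∑ j ∈ Finset.range M, _ := Finset.sum_le_sum fun j _ => hterm j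
    _ = 2 * ∑ j ∈ Finset.range M, ((j : ℝ) + 1) * ‖(T ^ (j + 1)) x - (T ^ j) x‖ ^ 2
        + 2 * (1 - r) * ∑ j ∈ Finset.range M, r ^ j * ‖(T ^ j) x‖ ^ 2 := by
      rw [Finset.sum_add_distrib, Finset.mul_sum, Finset.mul_sum]
    _ ≤ 2 * A + 2 * (1 - r) * (C ^ 2 * ‖x‖ ^ 2 * (1 - r)⁻¹) := by
      gcongr
      exact hA M
    _ = _ := by field_simp

end

/-- For a Tadmor–Ritt operator `T` on a Hilbert space, `T` satisfies square function
estimates if and only if `rT` satisfies square function estimates uniformly in `r ∈ (0,1)`. -/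
theorem square_function_estimates_iff_uniform_smul
    {H : Type*} [NormedAddCommGroup H] [InnerProductSpace ℂ H] [CompleteSpace H]
    (T : H →L[ℂ] H)
    (hspec : spectrum ℂ T ⊆ Metric.closedBall (0 : ℂ) 1)
    (hres : ∃ C : ℝ, ∀ z : ℂ, 1 < ‖z‖ → ‖(z - 1) • resolvent T z‖ ≤ C) :
    (∃ K : ℝ, 0 < K ∧ ∀ x : H,
        Summable (fun j : ℕ => ((j : ℝ) + 1) * ‖(T ^ (j + 1)) x - (T ^ j) x‖ ^ 2) ∧
        ∑' j : ℕ, ((j : ℝ) + 1) * ‖(T ^ (j + 1)) x - (T ^ j) x‖ ^ 2 ≤ K ^ 2 * ‖x‖ ^ 2) ↔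
    (∃ K : ℝ, 0 < K ∧ ∀ r : ℝ, r ∈ Set.Ioo (0 : ℝ) 1 → ∀ x : H,
        Summable (fun j : ℕ =>
          ((j : ℝ) + 1) * ‖r ^ (j + 1) • (T ^ (j + 1)) x - r ^ j • (T ^ j) x‖ ^ 2) ∧
        ∑' j : ℕ, ((j : ℝ) + 1) * ‖r ^ (j + 1) • (T ^ (j + 1)) x - r ^ j • (T ^ j) x‖ ^ 2
          ≤ K ^ 2 * ‖x‖ ^ 2) := by
  constructor
  · rintro ⟨K, hK, h⟩
    obtain ⟨C, hC⟩ := hres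
    refine ⟨√(2 * K ^ 2 + 2 * C ^ 2), Real.sqrt_pos.2 (by positivity), fun r hr x => ?_⟩
    have hA : ∀ M : ℕ, ∑ j ∈ Finset.range M, ((j : ℝ) + 1) * ‖(T ^ (j + 1)) x - (T ^ j) x‖ ^ 2
        ≤ K ^ 2 * ‖x‖ ^ 2 := fun M =>
      ((h x).1.sum_le_tsum _ fun i _ => by positivity).trans (h x).2
    have hb := sum_square_function_smul_le hspec hC hA hr
    rw [Real.sq_sqrt (by positivity)]
    refine ⟨summable_of_sum_range_le (fun j => by positivity) hb,
      (Real.tsum_le_of_sum_range_le (fun j => by positivity) hb).trans_eq (by ring)⟩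
  · rintro ⟨K, hK, h⟩
    refine ⟨K, hK, fun x => ?_⟩
    have hb : ∀ M : ℕ, ∑ j ∈ Finset.range M, ((j : ℝ) + 1) * ‖(T ^ (j + 1)) x - (T ^ j) x‖ ^ 2
        ≤ K ^ 2 * ‖x‖ ^ 2 := by
      intro M
      have hcont : Continuous fun r : ℝ => ∑ j ∈ Finset.range M,
          ((j : ℝ) + 1) * ‖r ^ (j + 1) • (T ^ (j + 1)) x - r ^ j • (T ^ j) x‖ ^ 2 := by
        fun_prop
      have hlim := (hcont.tendsto 1).mono_left (nhdsWithin_le_nhds (s := Set.Iio 1))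
      simp only [one_pow, one_smul] at hlim
      refine le_of_tendsto hlim ?_
      filter_upwards [Ioo_mem_nhdsLT (zero_lt_one' ℝ)] with r hr
      exact ((h r hr x).1.sum_le_tsum _ fun i _ => by positivity).trans (h r hr x).2
    exact ⟨summable_of_sum_range_le (fun j => by positivity) hb,
      Real.tsum_le_of_sum_range_le (fun j => by positivity) hb⟩
end
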